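/- arXiv:2101.07587 — 5 statements merged into one kernel-verified Lean document; each statement's English description precedes it below -/
import Mathlib

section
/- Let d ≥ 2 and α ∈ (0,1], and let W be a graphon on [0,1]^d (with Lebesgue measure) that is Hölder(α). Then there exists a measure-preserving map φ : [0,1] → [0,1]^d (both with Lebesgue measure) such that the pull-back W^φ(x,y) := W(φ(x), φ(y)) is a graphon on [0,1] that is Hölder(α/d). -/
open MeasureTheory
open scoped ENNReal

/-- The unit cube `[0,1]^d` in Euclidean space. -/
def unitCube (d : ℕ) : Set (EuclideanSpace ℝ (Fin d)) :=
  {x | ∀ i, x i ∈ Set.Icc (0:ℝ) 1}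

namespace PeanoCurve

open Filter Topology

/-- The three-fold zigzag map of `[0,1]`, extended to `ℝ`. -/
noncomputable def zigzag (x : ℝ) : ℝ := abs (1 - |3 * x - 1|)

/-- The three inverse branches of `zigzag` on `[0,1]`. -/
noncomputable def branch (j : Fin 3) (s : ℝ) : ℝ := ![s / 3, (2 - s) / 3, (2 + s) / 3] j

/-- The index of the monotonicity interval of `zigzag` containing `x`. -/
noncomputable def branchIndex (x : ℝ) : Fin 3 :=
  if x ≤ 1 / 3 then 0 else if x ≤ 2 / 3 then 1 else 2

lemma branch_zero (s : ℝ) : branch 0 s = s / 3 := rfl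

lemma branch_one (s : ℝ) : branch 1 s = (2 - s) / 3 := rfl

lemma branch_two (s : ℝ) : branch 2 s = (2 + s) / 3 := rfl

lemma abs_zigzag_sub_le (x y : ℝ) : |zigzag x - zigzag y| ≤ 3 * |x - y| := by
  have h1 := abs_abs_sub_abs_le (1 - |3 * x - 1|) (1 - |3 * y - 1|)
  have h2 := abs_abs_sub_abs_le (3 * y - 1) (3 * x - 1)
  rw [show (1 - |3 * x - 1|) - (1 - |3 * y - 1|) = |3 * y - 1| - |3 * x - 1| by ring] at h1
  rw [show 3 * y - 1 - (3 * x - 1) = (-3) * (x - y) by ring, abs_mul] at h2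
  norm_num at h2
  exact h1.trans h2

lemma abs_iterate_zigzag_sub_le (n : ℕ) (x y : ℝ) :
    |zigzag^[n] x - zigzag^[n] y| ≤ 3 ^ n * |x - y| := by
  induction n with
  | zero => simp
  | succ n ih =>
    rw [Function.iterate_succ_apply', Function.iterate_succ_apply']
    refine (abs_zigzag_sub_le _ _).trans ?_
    rw [pow_succ]
    linarith

lemma continuous_zigzag : Continuous zigzag := by unfold zigzag; fun_prop

lemma zigzag_zero : zigzag 0 = 0 := by norm_num [zigzag]

lemma zigzag_one : zigzag 1 = 1 := by norm_num [zigzag]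

lemma zigzag_one_third : zigzag (1 / 3) = 1 := by norm_num [zigzag]

lemma zigzag_two_thirds : zigzag (2 / 3) = 0 := by norm_num [zigzag]

lemma zigzag_branch (j : Fin 3) {s : ℝ} (hs : s ∈ Set.Icc (0 : ℝ) 1) :
    zigzag (branch j s) = s := by
  obtain ⟨h0, h1⟩ := hs
  fin_cases j
  · change abs (1 - |3 * (s / 3) - 1|) = s
    rw [abs_of_nonpos (a := 3 * (s / 3) - 1) (by linarith), abs_of_nonneg (by linarith)]
    ring
  · change abs (1 - |3 * ((2 - s) / 3) - 1|) = s
    rw [abs_of_nonneg (a := 3 * ((2 - s) / 3) - 1) (by linarith), abs_of_nonneg (by linarith)]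
    ring
  · change abs (1 - |3 * ((2 + s) / 3) - 1|) = s
    rw [abs_of_nonneg (a := 3 * ((2 + s) / 3) - 1) (by linarith), abs_of_nonpos (by linarith)]
    ring

lemma abs_branch_sub (j : Fin 3) (s t : ℝ) : |branch j s - branch j t| = |s - t| / 3 := by
  fin_cases j <;> simp only [branch] <;> simp
  · rw [← sub_div, abs_div]; norm_num
  · rw [← sub_div, abs_div, sub_sub_sub_cancel_left, abs_sub_comm]; norm_num
  · rw [← sub_div, abs_div]; norm_num

lemma branch_mem (j : Fin 3) {s : ℝ} (hs : s ∈ Set.Icc (0 : ℝ) 1) :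
    branch j s ∈ Set.Icc (0 : ℝ) 1 := by
  obtain ⟨h0, h1⟩ := hs
  fin_cases j <;> simp only [branch] <;> simp <;> constructor <;> linarith

lemma continuous_branch (j : Fin 3) : Continuous (branch j) := by
  fin_cases j
  · exact continuous_id.div_const 3
  · exact (continuous_const.sub continuous_id).div_const 3
  · exact (continuous_const.add continuous_id).div_const 3

lemma exists_branch_fixedPoint (T : ℝ → ℝ) :
    ∃ h : ℝ → ℝ, (∀ x, h x ∈ Set.Icc (0 : ℝ) 1) ∧
      ∀ x, h x = branch (branchIndex x) (h (T x)) := by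
  let H : ℕ → ℝ → ℝ := fun n => Nat.rec (fun _ => 0)
    (fun _ g x => branch (branchIndex x) (g (T x))) n
  have H_succ : ∀ n x, H (n + 1) x = branch (branchIndex x) (H n (T x)) := fun _ _ => rfl
  have H_mem : ∀ n x, H n x ∈ Set.Icc (0 : ℝ) 1 := by
    intro n
    induction n with
    | zero => intro x; simp [H]
    | succ n ih => intro x; rw [H_succ]; exact branch_mem _ (ih _)
  have H_dist : ∀ n x, dist (H n x) (H (n + 1) x) ≤ 1 * (1 / 3 : ℝ) ^ n := by
    intro n
    induction n with
    | zero =>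
      intro x
      have h0 := H_mem 0 x
      have h1 := H_mem 1 x
      rw [Real.dist_eq, abs_le]
      constructor <;> simp only [Set.mem_Icc] at h0 h1 <;> norm_num <;> linarith
    | succ n ih =>
      intro x
      rw [H_succ, H_succ (n + 1), Real.dist_eq, abs_branch_sub, ← Real.dist_eq, pow_succ]
      linarith [ih (T x)]
  have H_lim : ∀ x, ∃ l, Tendsto (fun n => H n x) atTop (𝓝 l) := fun x =>
    cauchySeq_tendsto_of_complete
      (cauchySeq_of_le_geometric (1 / 3 : ℝ) 1 (by norm_num) (fun n => H_dist n x))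
  choose h hh using H_lim
  refine ⟨h, fun x => isClosed_Icc.mem_of_tendsto (hh x) (Eventually.of_forall fun n => H_mem n x),
    fun x => ?_⟩
  refine tendsto_nhds_unique ((tendsto_add_atTop_iff_nat 1).2 (hh x)) ?_
  simp only [H_succ]
  exact ((continuous_branch _).tendsto _).comp (hh (T x))

/-- A solution of the functional equation satisfied by the first coordinate of the
`d`-dimensional Peano curve; the other coordinates are `fun x => h (zigzag^[i] x)`. -/
structure IsPeanoCoord (d : ℕ) (h : ℝ → ℝ) : Prop where
  pos : 0 < d
  mem : ∀ x, h x ∈ Set.Icc (0 : ℝ) 1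
  eq : ∀ x, h x = branch (branchIndex x) (h (zigzag^[d] x))

lemma exists_isPeanoCoord {d : ℕ} (hd : 0 < d) : ∃ h, IsPeanoCoord d h := by
  obtain ⟨h, h1, h2⟩ := exists_branch_fixedPoint zigzag^[d]
  exact ⟨h, hd, h1, h2⟩

namespace IsPeanoCoord

variable {d : ℕ} {h : ℝ → ℝ}

lemma apply_zero (H : IsPeanoCoord d h) : h 0 = 0 := by
  have := H.eq 0
  rw [Function.iterate_fixed zigzag_zero, branchIndex, if_pos (by norm_num)] at this
  simp [branch] at this
  linarith

lemma apply_one (H : IsPeanoCoord d h) : h 1 = 1 := by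
  have := H.eq 1
  rw [Function.iterate_fixed zigzag_one, branchIndex, if_neg (by norm_num),
    if_neg (by norm_num)] at this
  simp [branch] at this
  linarith

lemma apply_iterate_one_third (H : IsPeanoCoord d h) : h (zigzag^[d] (1 / 3)) = 1 := by
  obtain ⟨n, rfl⟩ := Nat.exists_eq_succ_of_ne_zero H.pos.ne'
  rw [Function.iterate_succ_apply, zigzag_one_third, Function.iterate_fixed zigzag_one,
    H.apply_one]

lemma apply_iterate_two_thirds (H : IsPeanoCoord d h) : h (zigzag^[d] (2 / 3)) = 0 := by
  obtain ⟨n, rfl⟩ := Nat.exists_eq_succ_of_ne_zero H.pos.ne'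
  rw [Function.iterate_succ_apply, zigzag_two_thirds, Function.iterate_fixed zigzag_zero,
    H.apply_zero]

lemma eq_of_le (H : IsPeanoCoord d h) {x : ℝ} (hx : x ≤ 1 / 3) :
    h x = branch 0 (h (zigzag^[d] x)) := by
  rw [H.eq x, branchIndex, if_pos hx]

lemma eq_of_mem (H : IsPeanoCoord d h) {x : ℝ} (hx : 1 / 3 ≤ x) (hx' : x ≤ 2 / 3) :
    h x = branch 1 (h (zigzag^[d] x)) := by
  rcases hx.eq_or_lt with rfl | hlt
  · rw [H.eq_of_le le_rfl, H.apply_iterate_one_third, branch_zero, branch_one]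
    norm_num
  · rw [H.eq x, branchIndex, if_neg hlt.not_ge, if_pos hx']

lemma eq_of_ge (H : IsPeanoCoord d h) {x : ℝ} (hx : 2 / 3 ≤ x) :
    h x = branch 2 (h (zigzag^[d] x)) := by
  rcases hx.eq_or_lt with rfl | hlt
  · rw [H.eq_of_mem (by norm_num) le_rfl, H.apply_iterate_two_thirds, branch_one, branch_two]
    norm_num
  · rw [H.eq x, branchIndex, if_neg (by linarith), if_neg hlt.not_ge]

lemma apply_branch (H : IsPeanoCoord d h) (j : Fin 3) {s : ℝ} (hs : s ∈ Set.Icc (0 : ℝ) 1) :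
    h (branch j s) = branch j (h (zigzag^[d] (branch j s))) := by
  obtain ⟨h0, h1⟩ := hs
  fin_cases j
  · exact H.eq_of_le (by simp [branch]; linarith)
  · exact H.eq_of_mem (by simp [branch]; linarith) (by simp [branch]; linarith)
  · exact H.eq_of_ge (by simp [branch]; linarith)

lemma abs_sub_le_one (H : IsPeanoCoord d h) (x y : ℝ) : |h x - h y| ≤ 1 := by
  have hx := H.mem x
  have hy := H.mem y
  rw [abs_le]
  constructor <;> linarith [hx.1, hx.2, hy.1, hy.2]

/-- Two points in a common monotonicity interval of `zigzag`: the self-similarity of `h`. -/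
lemma abs_sub_eq (H : IsPeanoCoord d h) {x y : ℝ}
    (hxy : (x ≤ 1 / 3 ∧ y ≤ 1 / 3) ∨ ((1 / 3 ≤ x ∧ x ≤ 2 / 3) ∧ (1 / 3 ≤ y ∧ y ≤ 2 / 3)) ∨
      (2 / 3 ≤ x ∧ 2 / 3 ≤ y)) :
    |h x - h y| = |h (zigzag^[d] x) - h (zigzag^[d] y)| / 3 := by
  rcases hxy with ⟨hx, hy⟩ | ⟨hx, hy⟩ | ⟨hx, hy⟩
  · rw [H.eq_of_le hx, H.eq_of_le hy, abs_branch_sub]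
  · rw [H.eq_of_mem hx.1 hx.2, H.eq_of_mem hy.1 hy.2, abs_branch_sub]
  · rw [H.eq_of_ge hx, H.eq_of_ge hy, abs_branch_sub]

lemma rpow_iterate_le (H : IsPeanoCoord d h) (x y : ℝ) :
    |zigzag^[d] x - zigzag^[d] y| ^ (1 / d : ℝ) ≤ 3 * |x - y| ^ (1 / d : ℝ) := by
  have hd : (d : ℝ) ≠ 0 := by exact_mod_cast H.pos.ne'
  calc |zigzag^[d] x - zigzag^[d] y| ^ (1 / d : ℝ)
      ≤ (3 ^ d * |x - y|) ^ (1 / d : ℝ) :=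
        Real.rpow_le_rpow (abs_nonneg _) (abs_iterate_zigzag_sub_le d x y) (by positivity)
    _ = 3 * |x - y| ^ (1 / d : ℝ) := by
        rw [Real.mul_rpow (by positivity) (abs_nonneg _), ← Real.rpow_natCast,
          ← Real.rpow_mul (by norm_num), mul_one_div_cancel hd, Real.rpow_one]

lemma one_le_of_one_third_le (H : IsPeanoCoord d h) {u : ℝ} (hu : 1 / 3 ≤ u) :
    1 ≤ 3 * u ^ (1 / d : ℝ) := by
  have hd : (1 : ℝ) ≤ d := by exact_mod_cast H.pos
  have h1 : (1 / 3 : ℝ) ^ (1 : ℝ) ≤ (1 / 3 : ℝ) ^ (1 / d : ℝ) :=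
    Real.rpow_le_rpow_of_exponent_ge (by norm_num) (by norm_num)
      ((div_le_one (by linarith)).2 hd)
  have h2 : (1 / 3 : ℝ) ^ (1 / d : ℝ) ≤ u ^ (1 / d : ℝ) :=
    Real.rpow_le_rpow (by norm_num) hu (by positivity)
  rw [Real.rpow_one] at h1
  linarith

lemma le_of_forall_le_add_geometric {a b : ℝ} (hab : ∀ n : ℕ, a ≤ b + (1 / 3 : ℝ) ^ n) :
    a ≤ b := by
  have ht : Tendsto (fun n : ℕ => b + (1 / 3 : ℝ) ^ n) atTop (𝓝 (b + 0)) :=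
    tendsto_const_nhds.add (tendsto_pow_atTop_nhds_zero_of_lt_one (by norm_num) (by norm_num))
  rw [add_zero] at ht
  exact ge_of_tendsto' ht hab

lemma abs_sub_le_of_fixed (H : IsPeanoCoord d h) {e : ℝ} (he : e = 0 ∨ e = 1) (x : ℝ) :
    |h x - h e| ≤ 3 * |x - e| ^ (1 / d : ℝ) := by
  have hfix : zigzag^[d] e = e := by
    rcases he with rfl | rfl
    · exact Function.iterate_fixed zigzag_zero d
    · exact Function.iterate_fixed zigzag_one d
  refine le_of_forall_le_add_geometric fun n => ?_
  induction n generalizing x with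
  | zero =>
    have := H.abs_sub_le_one x e
    have : 0 ≤ |x - e| ^ (1 / d : ℝ) := by positivity
    rw [pow_zero]
    linarith
  | succ n ih =>
    rcases le_total (1 / 3) |x - e| with hfar | hnear
    · have := H.abs_sub_le_one x e
      have := H.one_le_of_one_third_le hfar
      have : (0 : ℝ) ≤ (1 / 3) ^ (n + 1) := by positivity
      linarith
    · have hbr : (x ≤ 1 / 3 ∧ e ≤ 1 / 3) ∨
          ((1 / 3 ≤ x ∧ x ≤ 2 / 3) ∧ (1 / 3 ≤ e ∧ e ≤ 2 / 3)) ∨ (2 / 3 ≤ x ∧ 2 / 3 ≤ e) := by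
        rw [abs_le] at hnear
        rcases he with rfl | rfl
        · left; constructor <;> linarith
        · right; right; constructor <;> linarith
      rw [H.abs_sub_eq hbr]
      have h1 := ih (zigzag^[d] x)
      have h2 := H.rpow_iterate_le x e
      rw [hfix] at h2 ⊢
      rw [pow_succ]
      linarith

lemma abs_sub_le_of_thirds (H : IsPeanoCoord d h) {e : ℝ} (he : e = 1 / 3 ∨ e = 2 / 3) {x : ℝ}
    (hx : |x - e| ≤ 1 / 3) : |h x - h e| ≤ 3 * |x - e| ^ (1 / d : ℝ) := by
  have hfix : zigzag^[d] e = 0 ∨ zigzag^[d] e = 1 := by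
    obtain ⟨n, rfl⟩ := Nat.exists_eq_succ_of_ne_zero H.pos.ne'
    rw [Function.iterate_succ_apply]
    rcases he with rfl | rfl
    · rw [zigzag_one_third]; exact Or.inr (Function.iterate_fixed zigzag_one n)
    · rw [zigzag_two_thirds]; exact Or.inl (Function.iterate_fixed zigzag_zero n)
  have hbr : (x ≤ 1 / 3 ∧ e ≤ 1 / 3) ∨
      ((1 / 3 ≤ x ∧ x ≤ 2 / 3) ∧ (1 / 3 ≤ e ∧ e ≤ 2 / 3)) ∨ (2 / 3 ≤ x ∧ 2 / 3 ≤ e) := by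
    rw [abs_le] at hx
    rcases he with rfl | rfl
    · rcases le_total x (1 / 3) with hle | hle
      · exact Or.inl ⟨hle, le_rfl⟩
      · exact Or.inr (Or.inl ⟨⟨hle, by linarith⟩, le_rfl, by norm_num⟩)
    · rcases le_total x (2 / 3) with hle | hle
      · exact Or.inr (Or.inl ⟨⟨by linarith, hle⟩, by norm_num, le_rfl⟩)
      · exact Or.inr (Or.inr ⟨hle, le_rfl⟩)
  rw [H.abs_sub_eq hbr]
  have h1 := H.abs_sub_le_of_fixed hfix (zigzag^[d] x)
  have h2 := H.rpow_iterate_le x e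
  linarith

/-- The first coordinate of the `d`-dimensional Peano curve is Hölder of exponent `1 / d`. -/
lemma abs_sub_le (H : IsPeanoCoord d h) (x y : ℝ) :
    |h x - h y| ≤ 6 * |x - y| ^ (1 / d : ℝ) := by
  refine le_of_forall_le_add_geometric fun n => ?_
  induction n generalizing x y with
  | zero =>
    have := H.abs_sub_le_one x y
    have : 0 ≤ |x - y| ^ (1 / d : ℝ) := by positivity
    rw [pow_zero]
    linarith
  | succ n ih =>
    wlog hxy : x ≤ y generalizing x y
    · rw [abs_sub_comm, abs_sub_comm x]
      exact this y x (le_of_not_ge hxy)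
    have hpow : (0 : ℝ) ≤ (1 / 3) ^ (n + 1) := by positivity
    have hrpow : 0 ≤ |x - y| ^ (1 / d : ℝ) := by positivity
    by_cases hbr : (x ≤ 1 / 3 ∧ y ≤ 1 / 3) ∨
        ((1 / 3 ≤ x ∧ x ≤ 2 / 3) ∧ (1 / 3 ≤ y ∧ y ≤ 2 / 3)) ∨ (2 / 3 ≤ x ∧ 2 / 3 ≤ y)
    · rw [H.abs_sub_eq hbr]
      have h1 := ih (zigzag^[d] x) (zigzag^[d] y)
      have h2 := H.rpow_iterate_le x y
      rw [pow_succ]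
      linarith
    rcases le_total (1 / 3) |x - y| with hfar | hnear
    · have := H.abs_sub_le_one x y
      have := H.one_le_of_one_third_le hfar
      linarith
    obtain ⟨e, he, hxe, hey⟩ : ∃ e : ℝ, (e = 1 / 3 ∨ e = 2 / 3) ∧ x ≤ e ∧ e ≤ y := by
      by_contra! hcon
      have h1 := hcon (1 / 3) (Or.inl rfl)
      have h2 := hcon (2 / 3) (Or.inr rfl)
      refine hbr ?_
      rcases le_or_gt x (1 / 3) with hx1 | hx1
      · exact Or.inl ⟨hx1, (h1 hx1).le⟩
      rcases le_or_gt x (2 / 3) with hx2 | hx2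
      · exact Or.inr (Or.inl ⟨⟨hx1.le, hx2⟩, by linarith, (h2 hx2).le⟩)
      · exact Or.inr (Or.inr ⟨hx2.le, by linarith⟩)
    have hx_near : |x - e| ≤ |x - y| := by
      rw [abs_of_nonpos (by linarith), abs_of_nonpos (by linarith)]; linarith
    have hy_near : |y - e| ≤ |x - y| := by
      rw [abs_of_nonneg (by linarith), abs_of_nonpos (by linarith)]; linarith
    have h1 := H.abs_sub_le_of_thirds he (hx_near.trans hnear)
    have h2 := H.abs_sub_le_of_thirds he (hy_near.trans hnear)
    have h3 : |x - e| ^ (1 / d : ℝ) ≤ |x - y| ^ (1 / d : ℝ) :=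
      Real.rpow_le_rpow (abs_nonneg _) hx_near (by positivity)
    have h4 : |y - e| ^ (1 / d : ℝ) ≤ |x - y| ^ (1 / d : ℝ) :=
      Real.rpow_le_rpow (abs_nonneg _) hy_near (by positivity)
    have h5 := _root_.abs_sub_le (h x) (h e) (h y)
    rw [abs_sub_comm (h e)] at h5
    linarith

lemma continuous (H : IsPeanoCoord d h) : Continuous h := by
  have hd : (0 : ℝ) < 1 / d := by have := H.pos; positivity
  rw [continuous_iff_continuousAt]
  intro x
  rw [ContinuousAt, tendsto_iff_dist_tendsto_zero]
  have hlim : Tendsto (fun y => 6 * |y - x| ^ (1 / d : ℝ)) (𝓝 x) (𝓝 0) := by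
    have hc : Continuous fun y : ℝ => 6 * |y - x| ^ (1 / d : ℝ) :=
      continuous_const.mul ((by fun_prop : Continuous fun y : ℝ => |y - x|).rpow_const
        fun _ => Or.inr hd.le)
    simpa [Real.zero_rpow (by simpa using hd.ne' : (d : ℝ)⁻¹ ≠ 0)] using hc.tendsto x
  exact squeeze_zero (fun _ => dist_nonneg) (fun y => H.abs_sub_le y x) hlim

end IsPeanoCoord

/-- Lebesgue measure on `[0,1]`. -/
noncomputable abbrev unitMeasure : Measure ℝ := volume.restrict (Set.Icc (0 : ℝ) 1)

instance : IsProbabilityMeasure unitMeasure := ⟨by simp⟩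

/-- Lebesgue measure on `[0,1]` is the average of its images under the three branches. -/
lemma integral_unitMeasure_eq {g : ℝ → ℂ} (hg : Continuous g) :
    ∫ s, g s ∂unitMeasure = (3 : ℝ)⁻¹ • ∑ j, ∫ s, g (branch j s) ∂unitMeasure := by
  have key : ∀ f : ℝ → ℂ, ∫ s, f s ∂unitMeasure = ∫ s in (0 : ℝ)..1, f s := fun f => by
    rw [intervalIntegral.integral_of_le zero_le_one, integral_Icc_eq_integral_Ioc]
  have hi : ∀ a b : ℝ, IntervalIntegrable g volume a b := fun a b => hg.intervalIntegrable a b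
  have h0 : ∫ s in (0 : ℝ)..1, g (branch 0 s) = (3 : ℝ) • ∫ s in (0 : ℝ)..(1 / 3), g s := by
    have := intervalIntegral.integral_comp_div (a := 0) (b := 1) g (three_ne_zero (α := ℝ))
    rwa [zero_div] at this
  have h1 : ∫ s in (0 : ℝ)..1, g (branch 1 s) =
      (3 : ℝ) • ∫ s in (1 / 3 : ℝ)..(2 / 3), g s := by
    have := intervalIntegral.integral_comp_sub_div (a := 0) (b := 1) g (three_ne_zero (α := ℝ))
      (2 / 3)
    rw [zero_div, sub_zero, show (2 / 3 : ℝ) - 1 / 3 = 1 / 3 by norm_num] at this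
    simpa only [branch_one, sub_div] using this
  have h2 : ∫ s in (0 : ℝ)..1, g (branch 2 s) = (3 : ℝ) • ∫ s in (2 / 3 : ℝ)..1, g s := by
    have := intervalIntegral.integral_comp_add_div (a := 0) (b := 1) g (three_ne_zero (α := ℝ))
      (2 / 3)
    rw [zero_div, add_zero, show (2 / 3 : ℝ) + 1 / 3 = 1 by norm_num] at this
    simpa only [branch_two, add_div] using this
  simp only [key, Fin.sum_univ_three]
  rw [h0, h1, h2, ← smul_add, ← smul_add, smul_smul, inv_mul_cancel₀ three_ne_zero, one_smul,
    intervalIntegral.integral_add_adjacent_intervals (hi _ _) (hi _ _),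
    intervalIntegral.integral_add_adjacent_intervals (hi _ _) (hi _ _)]

/-- Uniform measure on the unit cube of `Fin n → ℝ`. -/
noncomputable abbrev cubeMeasure (n : ℕ) : Measure (Fin n → ℝ) := Measure.pi fun _ => unitMeasure

variable {n : ℕ}

/-- The similarity of the cube that rotates the coordinates cyclically
and then applies a branch to the first one. -/
noncomputable def cubeBranch (j : Fin 3) (y : Fin (n + 1) → ℝ) : Fin (n + 1) → ℝ :=
  Fin.cons (branch j (y (Fin.last n))) (Fin.init y)

lemma continuous_cubeBranch (j : Fin 3) :
    Continuous (cubeBranch j : (Fin (n + 1) → ℝ) → Fin (n + 1) → ℝ) := by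
  refine continuous_pi fun i => ?_
  refine Fin.cases ?_ (fun i => ?_) i
  · simpa [cubeBranch, Function.comp_def] using
      (continuous_branch j).comp (continuous_apply (Fin.last n))
  · simpa [cubeBranch, Fin.init] using continuous_apply i.castSucc

lemma integrable_of_bounded {X : Type*} [MeasurableSpace X] [TopologicalSpace X]
    [OpensMeasurableSpace X] {μ : Measure X} [IsFiniteMeasure μ] {f : X → ℂ}
    (hf : Continuous f) (hb : ∀ x, ‖f x‖ ≤ 1) : Integrable f μ :=
  .of_bound hf.measurable.aestronglyMeasurable 1 (Eventually.of_forall hb)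

lemma integral_cubeMeasure_cons {f : (Fin (n + 1) → ℝ) → ℂ} (hf : Continuous f)
    (hb : ∀ x, ‖f x‖ ≤ 1) :
    ∫ x, f x ∂cubeMeasure (n + 1) =
      ∫ z, ∫ a, f (Fin.cons a z) ∂unitMeasure ∂cubeMeasure n := by
  have := (measurePreserving_piFinSuccAbove (fun _ : Fin (n + 1) => unitMeasure) 0).symm
  rw [← this.integral_comp', integral_prod_symm]
  · simp [MeasurableEquiv.piFinSuccAbove_symm_apply, Fin.insertNthEquiv, Fin.insertNth_zero']
  · exact this.integrable_comp_of_integrable (integrable_of_bounded hf hb)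

lemma integral_cubeMeasure_snoc {f : (Fin (n + 1) → ℝ) → ℂ} (hf : Continuous f)
    (hb : ∀ x, ‖f x‖ ≤ 1) :
    ∫ x, f x ∂cubeMeasure (n + 1) =
      ∫ z, ∫ a, f (Fin.snoc (α := fun _ => ℝ) z a) ∂unitMeasure ∂cubeMeasure n := by
  have := (measurePreserving_piFinSuccAbove (fun _ : Fin (n + 1) => unitMeasure) (Fin.last n)).symm
  rw [← this.integral_comp', integral_prod_symm]
  · simp [MeasurableEquiv.piFinSuccAbove_symm_apply, Fin.insertNthEquiv, Fin.insertNth_last']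
  · exact this.integrable_comp_of_integrable (integrable_of_bounded hf hb)

lemma integral_cubeMeasure_eq {f : (Fin (n + 1) → ℝ) → ℂ} (hf : Continuous f)
    (hb : ∀ x, ‖f x‖ ≤ 1) :
    ∫ x, f x ∂cubeMeasure (n + 1) =
      (3 : ℝ)⁻¹ • ∑ j, ∫ x, f (cubeBranch j x) ∂cubeMeasure (n + 1) := by
  have hcons : Continuous fun p : (Fin n → ℝ) × ℝ => f (Fin.cons p.2 p.1) :=
    hf.comp (Continuous.finCons (A := fun _ => ℝ) continuous_snd continuous_fst)
  have hswap : ∀ j, ∫ x, f (cubeBranch j x) ∂cubeMeasure (n + 1) =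
      ∫ z, ∫ a, f (Fin.cons (branch j a) z) ∂unitMeasure ∂cubeMeasure n := fun j => by
    rw [integral_cubeMeasure_snoc (f := fun x => f (cubeBranch j x))
      (hf.comp (continuous_cubeBranch j)) fun _ => hb _]
    simp [cubeBranch]
  simp only [hswap]
  rw [integral_cubeMeasure_cons hf hb, ← integral_finsetSum, ← integral_smul]
  · congr 1
    ext z
    exact integral_unitMeasure_eq (hcons.comp (Continuous.prodMk_right z))
  · intro j _
    have hj : Continuous fun p : (Fin n → ℝ) × ℝ => f (Fin.cons (branch j p.2) p.1) :=
      hf.comp (Continuous.finCons (A := fun _ => ℝ) ((continuous_branch j).comp continuous_snd)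
        continuous_fst)
    exact (integrable_of_bounded (μ := (cubeMeasure n).prod unitMeasure) hj
      fun _ => hb _).integral_prod_left

/-- The Peano curve with first coordinate `h`. -/
noncomputable def curve (n : ℕ) (h : ℝ → ℝ) (t : ℝ) : Fin n → ℝ := fun i => h (zigzag^[i] t)

section curve

variable {h : ℝ → ℝ}

lemma continuous_curve (H : IsPeanoCoord n h) : Continuous (curve n h) :=
  continuous_pi fun i => H.continuous.comp (continuous_zigzag.iterate i)

lemma curve_branch (H : IsPeanoCoord (n + 1) h) (j : Fin 3) {s : ℝ}
    (hs : s ∈ Set.Icc (0 : ℝ) 1) :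
    curve (n + 1) h (branch j s) = cubeBranch j (curve (n + 1) h s) := by
  ext i
  refine Fin.cases ?_ (fun i => ?_) i
  · simp only [curve, cubeBranch, Fin.cons_zero, Fin.val_zero, Function.iterate_zero, id_eq,
      Fin.val_last]
    rw [H.apply_branch j hs, Function.iterate_succ_apply, zigzag_branch j hs]
  · simp only [curve, cubeBranch, Fin.cons_succ, Fin.init, Fin.val_succ, Fin.val_castSucc]
    rw [Function.iterate_succ_apply, zigzag_branch j hs]

lemma integral_curve_eq (H : IsPeanoCoord (n + 1) h) {f : (Fin (n + 1) → ℝ) → ℂ}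
    (hf : Continuous f) :
    ∫ s, f (curve (n + 1) h s) ∂unitMeasure =
      (3 : ℝ)⁻¹ • ∑ j, ∫ s, f (cubeBranch j (curve (n + 1) h s)) ∂unitMeasure := by
  have hcomp : Continuous fun s => f (curve (n + 1) h s) := hf.comp (continuous_curve H)
  rw [integral_unitMeasure_eq hcomp]
  congr 1
  refine Finset.sum_congr rfl fun j _ => ?_
  refine setIntegral_congr_fun measurableSet_Icc fun s hs => ?_
  simp only [curve_branch H j hs]

lemma norm_integral_sub_apply_le {X : Type*} [MeasurableSpace X] {μ : Measure X}
    [IsProbabilityMeasure μ] {f : X → ℂ} (hf : Integrable f μ) (c : ℂ) {K : ℝ}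
    (hK : ∀ᵐ x ∂μ, ‖f x - c‖ ≤ K) : ‖∫ x, f x ∂μ - c‖ ≤ K := by
  have h1 : ∫ x, f x ∂μ - c = ∫ x, (f x - c) ∂μ := by
    rw [integral_sub hf (integrable_const c)]; simp
  rw [h1]
  simpa using norm_integral_le_of_norm_le_const hK

lemma ae_cubeMeasure_mem (n : ℕ) :
    ∀ᵐ x ∂cubeMeasure n, ∀ i, x i ∈ Set.Icc (0 : ℝ) 1 := by
  rw [ae_all_iff]
  intro i
  have : ∀ᵐ s ∂unitMeasure, s ∈ Set.Icc (0 : ℝ) 1 := ae_restrict_mem measurableSet_Icc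
  exact (Measure.tendsto_eval_ae_ae (μ := fun _ : Fin n => unitMeasure) (i := i)).eventually this

/-- The weighted `ℓ¹` distance which every `cubeBranch` contracts by the factor `r`,
if `r ^ (n + 1) = 1 / 3`. -/
lemma sum_weighted_cubeBranch {r : ℝ} (hr : r ^ (n + 1) = 1 / 3) (j : Fin 3)
    (x y : Fin (n + 1) → ℝ) :
    ∑ i : Fin (n + 1), r ^ (i : ℕ) * |cubeBranch j x i - cubeBranch j y i| =
      r * ∑ i : Fin (n + 1), r ^ (i : ℕ) * |x i - y i| := by
  rw [Fin.sum_univ_succ, Fin.sum_univ_castSucc (fun i : Fin (n + 1) => r ^ (i : ℕ) * |x i - y i|)]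
  simp only [cubeBranch, Fin.cons_zero, Fin.cons_succ, Fin.init, abs_branch_sub, Fin.val_zero,
    Fin.val_succ, Fin.val_castSucc, Fin.val_last, mul_add, Finset.mul_sum]
  rw [add_comm]
  congr 1
  · exact Finset.sum_congr rfl fun i _ => by ring
  · rw [pow_zero, ← mul_assoc, ← pow_succ', hr]; ring

lemma norm_integral_curve_sub_le (H : IsPeanoCoord (n + 1) h) {r : ℝ} (hr0 : 0 ≤ r)
    (hr1 : r ≤ 1) (hr : r ^ (n + 1) = 1 / 3) (k : ℕ) {K : ℝ} (hK0 : 0 ≤ K)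
    {f : (Fin (n + 1) → ℝ) → ℂ}
    (hf : Continuous f) (hb : ∀ x, ‖f x‖ ≤ 1)
    (hK : ∀ x y, ‖f x - f y‖ ≤ K * ∑ i : Fin (n + 1), r ^ (i : ℕ) * |x i - y i|) :
    ‖∫ s, f (curve (n + 1) h s) ∂unitMeasure - ∫ x, f x ∂cubeMeasure (n + 1)‖ ≤
      K * (2 * (n + 1)) * r ^ k := by
  induction k generalizing K f with
  | zero =>
    have hcube : ∀ x : Fin (n + 1) → ℝ, (∀ i, x i ∈ Set.Icc (0 : ℝ) 1) →
        ‖f x - f 0‖ ≤ K * (n + 1) := fun x hx => by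
      refine (hK x 0).trans (mul_le_mul_of_nonneg_left ?_ hK0)
      calc ∑ i : Fin (n + 1), r ^ (i : ℕ) * |x i - (0 : Fin (n + 1) → ℝ) i|
          ≤ ∑ _i : Fin (n + 1), (1 : ℝ) := Finset.sum_le_sum fun i _ => by
            rw [Pi.zero_apply, sub_zero, abs_of_nonneg (hx i).1]
            exact mul_le_one₀ (pow_le_one₀ hr0 hr1) (hx i).1 (hx i).2
        _ = n + 1 := by simp
    have h1 := norm_integral_sub_apply_le (μ := unitMeasure)
      (integrable_of_bounded (hf.comp (continuous_curve H)) fun _ => hb _) (f 0)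
      (Eventually.of_forall fun s => hcube (curve (n + 1) h s) fun i => H.mem _)
    have h2 := norm_integral_sub_apply_le (μ := cubeMeasure (n + 1))
      (integrable_of_bounded hf hb) (f 0) ((ae_cubeMeasure_mem (n + 1)).mono hcube)
    rw [norm_sub_rev] at h2
    have h3 := norm_sub_le_norm_sub_add_norm_sub
      (∫ s, f (curve (n + 1) h s) ∂unitMeasure) (f 0) (∫ x, f x ∂cubeMeasure (n + 1))
    simp only [Function.comp_apply] at h1
    rw [pow_zero]
    linarith
  | succ k ih =>
    rw [integral_curve_eq H hf, integral_cubeMeasure_eq hf hb, ← smul_sub,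
      ← Finset.sum_sub_distrib, norm_smul]
    have hj : ∀ j, ‖∫ s, f (cubeBranch j (curve (n + 1) h s)) ∂unitMeasure -
        ∫ x, f (cubeBranch j x) ∂cubeMeasure (n + 1)‖ ≤ K * r * (2 * (n + 1)) * r ^ k := fun j =>
      ih (f := fun x => f (cubeBranch j x)) (mul_nonneg hK0 hr0)
        (hf.comp (continuous_cubeBranch j)) (fun _ => hb _) fun x y => by
          rw [mul_assoc, ← sum_weighted_cubeBranch hr j]; exact hK _ _
    have hsum := norm_sum_le_of_le Finset.univ fun j _ => hj j
    rw [Finset.sum_const, Finset.card_univ, Fintype.card_fin, nsmul_eq_mul] at hsum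
    rw [Real.norm_of_nonneg (by norm_num : (0 : ℝ) ≤ 3⁻¹), pow_succ]
    push_cast at hsum
    linarith

lemma integral_curve_eq_integral_cubeMeasure (H : IsPeanoCoord (n + 1) h) {K : ℝ}
    (hK0 : 0 ≤ K) {f : (Fin (n + 1) → ℝ) → ℂ} (hf : Continuous f) (hb : ∀ x, ‖f x‖ ≤ 1)
    (hK : ∀ x y, ‖f x - f y‖ ≤ K * ‖x - y‖) :
    ∫ s, f (curve (n + 1) h s) ∂unitMeasure = ∫ x, f x ∂cubeMeasure (n + 1) := by
  obtain ⟨r, hr0, hr⟩ : ∃ r : ℝ, 0 < r ∧ r ^ (n + 1) = 1 / 3 :=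
    ⟨(1 / 3 : ℝ) ^ ((n + 1 : ℕ) : ℝ)⁻¹, by positivity,
      Real.rpow_inv_natCast_pow (by norm_num) (by simp)⟩
  have hr1 : r < 1 := by
    by_contra! hcon
    have := one_le_pow₀ hcon (n := n + 1)
    linarith
  have hK' : ∀ x y, ‖f x - f y‖ ≤ K / r ^ n * ∑ i : Fin (n + 1), r ^ (i : ℕ) * |x i - y i| :=
      fun x y => by
    refine (hK x y).trans ?_
    rw [div_mul_eq_mul_div, mul_div_assoc]
    refine mul_le_mul_of_nonneg_left ?_ hK0
    rw [pi_norm_le_iff_of_nonneg (by positivity)]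
    intro i
    rw [le_div_iff₀ (by positivity), Pi.sub_apply, Real.norm_eq_abs, mul_comm]
    calc r ^ n * |x i - y i| ≤ r ^ (i : ℕ) * |x i - y i| :=
          mul_le_mul_of_nonneg_right
            (pow_le_pow_of_le_one hr0.le hr1.le (Nat.lt_succ_iff.1 i.2)) (abs_nonneg _)
      _ ≤ ∑ i : Fin (n + 1), r ^ (i : ℕ) * |x i - y i| :=
          Finset.single_le_sum (f := fun i : Fin (n + 1) => r ^ (i : ℕ) * |x i - y i|)
            (fun i _ => by positivity) (Finset.mem_univ i)
  rw [← sub_eq_zero, ← norm_le_zero_iff]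
  have hlim : Tendsto (fun k : ℕ => K / r ^ n * (2 * (n + 1)) * r ^ k) atTop
      (𝓝 (K / r ^ n * (2 * (n + 1)) * 0)) :=
    (tendsto_pow_atTop_nhds_zero_of_lt_one hr0.le hr1).const_mul _
  rw [mul_zero] at hlim
  exact ge_of_tendsto' hlim fun k =>
    norm_integral_curve_sub_le H hr0.le hr1.le hr k (by positivity) hf hb hK'

lemma measurePreserving_curve (H : IsPeanoCoord (n + 1) h) :
    MeasurePreserving (curve (n + 1) h) unitMeasure (cubeMeasure (n + 1)) := by
  have hmeas := (continuous_curve H).measurable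
  have : IsProbabilityMeasure (unitMeasure.map (curve (n + 1) h)) :=
    Measure.isProbabilityMeasure_map hmeas.aemeasurable
  refine ⟨hmeas, Measure.ext_of_charFunDual (funext fun L => ?_)⟩
  have hc : Continuous fun v : Fin (n + 1) → ℝ => Complex.exp (L v * Complex.I) := by fun_prop
  rw [charFunDual_apply, charFunDual_apply,
    integral_map hmeas.aemeasurable hc.aestronglyMeasurable]
  refine integral_curve_eq_integral_cubeMeasure H (norm_nonneg L) hc
    (fun v => (Complex.norm_exp_ofReal_mul_I _).le) fun x y => ?_
  have hxy : Complex.exp (L x * Complex.I) - Complex.exp (L y * Complex.I) =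
      Complex.exp (L y * Complex.I) * (Complex.exp (Complex.I * ((L (x - y) : ℝ) : ℂ)) - 1) := by
    rw [mul_sub, ← Complex.exp_add, mul_one, map_sub]
    push_cast
    ring_nf
  rw [hxy, norm_mul, Complex.norm_exp_ofReal_mul_I, one_mul]
  exact Real.norm_exp_I_mul_ofReal_sub_one_le.trans (L.le_opNorm _)

end curve

/-- There is a `1 / d`-Hölder curve carrying Lebesgue measure on `[0,1]` to Lebesgue measure
on `[0,1]^d`. -/
theorem exists_measurePreserving_holder {d : ℕ} (hd : 0 < d) :
    ∃ φ : ℝ → EuclideanSpace ℝ (Fin d),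
      MeasurePreserving φ (volume.restrict (Set.Icc (0 : ℝ) 1)) (volume.restrict (unitCube d)) ∧
      (∀ t, φ t ∈ unitCube d) ∧
      ∃ M : ℝ, 0 ≤ M ∧ ∀ s t, dist (φ s) (φ t) ≤ M * |s - t| ^ (1 / d : ℝ) := by
  obtain ⟨n, rfl⟩ := Nat.exists_eq_succ_of_ne_zero hd.ne'
  obtain ⟨h, H⟩ := exists_isPeanoCoord hd
  refine ⟨fun t => WithLp.toLp 2 (curve (n + 1) h t), ?_, fun t i => H.mem _,
    ∑ i : Fin (n + 1), 6 * (3 ^ (i : ℕ)) ^ (1 / (n + 1 : ℕ) : ℝ), by positivity, fun s t => ?_⟩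
  · have hcube : MeasurePreserving (WithLp.toLp 2) (cubeMeasure (n + 1))
        (volume.restrict (unitCube (n + 1))) := by
      have hset : MeasurableSet (unitCube (n + 1)) := by
        have : unitCube (n + 1) = ⋂ i, (fun x : EuclideanSpace ℝ (Fin (n + 1)) => x i) ⁻¹'
            Set.Icc (0 : ℝ) 1 := by ext; simp [unitCube]
        rw [this]
        exact MeasurableSet.iInter fun i => measurableSet_Icc.preimage (by fun_prop)
      have := (PiLp.volume_preserving_toLp (Fin (n + 1))).restrict_preimage hset
      have hpre : WithLp.toLp 2 ⁻¹' unitCube (n + 1) =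
          Set.univ.pi fun _ : Fin (n + 1) => Set.Icc (0 : ℝ) 1 := by
        ext x; simp [unitCube, Pi.le_def, forall_and]
      rw [hpre, volume_pi, Measure.restrict_pi_pi] at this
      exact this
    exact hcube.comp (measurePreserving_curve H)
  · calc dist (WithLp.toLp 2 (curve (n + 1) h s)) (WithLp.toLp 2 (curve (n + 1) h t))
        ≤ ∑ i, |curve (n + 1) h s i - curve (n + 1) h t i| := by
          rw [EuclideanSpace.dist_eq]
          refine Real.sqrt_le_iff.2 ⟨by positivity, ?_⟩
          exact Finset.sum_sq_le_sq_sum_of_nonneg fun i _ => abs_nonneg _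
      _ ≤ ∑ i : Fin (n + 1), 6 * (3 ^ (i : ℕ)) ^ (1 / (n + 1 : ℕ) : ℝ) *
            |s - t| ^ (1 / (n + 1 : ℕ) : ℝ) := Finset.sum_le_sum fun i _ => by
          refine (H.abs_sub_le _ _).trans ?_
          rw [mul_assoc, ← Real.mul_rpow (by positivity) (abs_nonneg _)]
          exact mul_le_mul_of_nonneg_left (Real.rpow_le_rpow (abs_nonneg _)
            (abs_iterate_zigzag_sub_le _ _ _) (by positivity)) (by norm_num)
      _ = _ := by rw [Finset.sum_mul]

end PeanoCurve

/-- A Hölder(α) graphon on `[0,1]^d` (d ≥ 2) can be pulled back by a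
measure-preserving map `φ : [0,1] → [0,1]^d` to a graphon on `[0,1]` that is Hölder(α/d). -/
theorem holder_graphon_pullback_to_interval
    (d : ℕ) (hd : 2 ≤ d) (α : ℝ) (hα0 : 0 < α) (hα1 : α ≤ 1)
    (W : EuclideanSpace ℝ (Fin d) → EuclideanSpace ℝ (Fin d) → ℝ)
    (hWmeas : Measurable (Function.uncurry W))
    (hWsymm : ∀ x ∈ unitCube d, ∀ y ∈ unitCube d, W x y = W y x)
    (hW01 : ∀ x ∈ unitCube d, ∀ y ∈ unitCube d, W x y ∈ Set.Icc (0:ℝ) 1)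
    (hWHolder : ∃ C : ℝ, ∀ x ∈ unitCube d, ∀ y ∈ unitCube d, ∀ x' ∈ unitCube d,
      ∀ y' ∈ unitCube d,
      |W x y - W x' y'| ≤ C * Real.sqrt (dist x x' ^ 2 + dist y y' ^ 2) ^ α) :
    ∃ φ : ℝ → EuclideanSpace ℝ (Fin d),
      MeasurePreserving φ (volume.restrict (Set.Icc (0:ℝ) 1))
        (volume.restrict (unitCube d)) ∧
      Set.MapsTo φ (Set.Icc (0:ℝ) 1) (unitCube d) ∧
      Measurable (Function.uncurry fun x y : ℝ => W (φ x) (φ y)) ∧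
      (∀ x ∈ Set.Icc (0:ℝ) 1, ∀ y ∈ Set.Icc (0:ℝ) 1, W (φ x) (φ y) = W (φ y) (φ x)) ∧
      (∀ x ∈ Set.Icc (0:ℝ) 1, ∀ y ∈ Set.Icc (0:ℝ) 1, W (φ x) (φ y) ∈ Set.Icc (0:ℝ) 1) ∧
      ∃ C : ℝ, ∀ x ∈ Set.Icc (0:ℝ) 1, ∀ y ∈ Set.Icc (0:ℝ) 1,
        ∀ x' ∈ Set.Icc (0:ℝ) 1, ∀ y' ∈ Set.Icc (0:ℝ) 1,
        |W (φ x) (φ y) - W (φ x') (φ y')| ≤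
          C * Real.sqrt ((x - x') ^ 2 + (y - y') ^ 2) ^ (α / d) := by
  obtain ⟨φ, hφ, hmem, M, hM0, hM⟩ :=
    PeanoCurve.exists_measurePreserving_holder (zero_lt_two.trans_le hd)
  obtain ⟨C, hC⟩ := hWHolder
  refine ⟨φ, hφ, fun t _ => hmem t, ?_, fun x _ y _ => hWsymm _ (hmem x) _ (hmem y),
    fun x _ y _ => hW01 _ (hmem x) _ (hmem y), |C| * (√2 * M) ^ α, fun x _ y _ x' _ y' _ => ?_⟩
  · exact hWmeas.comp ((hφ.measurable.comp measurable_fst).prodMk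
      (hφ.measurable.comp measurable_snd))
  set ρ := √((x - x') ^ 2 + (y - y') ^ 2)
  have hρ0 : 0 ≤ ρ := Real.sqrt_nonneg _
  have hx : dist (φ x) (φ x') ≤ M * ρ ^ (1 / d : ℝ) :=
    (hM x x').trans (mul_le_mul_of_nonneg_left (Real.rpow_le_rpow (abs_nonneg _)
      (Real.abs_le_sqrt (le_add_of_nonneg_right (sq_nonneg _))) (by positivity)) hM0)
  have hy : dist (φ y) (φ y') ≤ M * ρ ^ (1 / d : ℝ) :=
    (hM y y').trans (mul_le_mul_of_nonneg_left (Real.rpow_le_rpow (abs_nonneg _)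
      (Real.abs_le_sqrt (le_add_of_nonneg_left (sq_nonneg _))) (by positivity)) hM0)
  have hdist : √(dist (φ x) (φ x') ^ 2 + dist (φ y) (φ y') ^ 2) ≤
      √2 * M * ρ ^ (1 / d : ℝ) := by
    refine Real.sqrt_le_iff.2 ⟨by positivity, ?_⟩
    rw [mul_assoc, mul_pow, Real.sq_sqrt zero_le_two, two_mul]
    gcongr
  calc |W (φ x) (φ y) - W (φ x') (φ y')|
      ≤ C * √(dist (φ x) (φ x') ^ 2 + dist (φ y) (φ y') ^ 2) ^ α :=
        hC _ (hmem x) _ (hmem y) _ (hmem x') _ (hmem y')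
    _ ≤ |C| * (√2 * M * ρ ^ (1 / d : ℝ)) ^ α := by
        gcongr
        exact le_abs_self C
    _ = |C| * (√2 * M) ^ α * ρ ^ (α / d) := by
        rw [Real.mul_rpow (by positivity) (by positivity), ← Real.rpow_mul hρ0,
          one_div_mul_eq_div, mul_assoc]
end

section
/- For every integer d ≥ 2 there exists a map φ : [0,1] → [0,1]^d that is measure-preserving (from Lebesgue measure on [0,1] to Lebesgue measure on [0,1]^d) and is Hölder(1/d), i.e., there is a constant C < ∞ with |φ(s) − φ(t)| ≤ C|s − t|^{1/d} for all s, t ∈ [0,1]. -/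
open MeasureTheory
open scoped ENNReal

section PeanoCell

variable {ι : Type*} [Fintype ι] [DecidableEq ι]

/-- The `m`-th cell visited by the Peano curve after `k` ternary subdivisions, the `j`-th of which
splits the coordinate `c j`. The splitting direction is reversed according to the parity of the sum
of the other coordinates, which is written here as the parity of `∑ j, g j + g (c k)`. -/
def peanoCell (c : ℕ → ι) : ℕ → ℕ → ι → ℕ
  | 0, m => Pi.single (c 0) m
  | k + 1, m =>
    Function.update (peanoCell c k (m / 3)) (c k)
      (3 * peanoCell c k (m / 3) (c k) +
        if Even (∑ j, peanoCell c k (m / 3) j + peanoCell c k (m / 3) (c k)) then m % 3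
        else 2 - m % 3)

theorem sum_update_add (g : ι → ℕ) (i : ι) (v : ℕ) :
    ∑ j, Function.update g i v j + g i = ∑ j, g j + v := by
  rw [Finset.sum_update_of_mem (Finset.mem_univ i), ← Finset.sum_sdiff (Finset.subset_univ {i})]
  simp
  ring

theorem peanoCell_succ_self (c : ℕ → ι) (k m : ℕ) :
    peanoCell c (k + 1) m (c k) = 3 * peanoCell c k (m / 3) (c k) +
        if Even (∑ j, peanoCell c k (m / 3) j + peanoCell c k (m / 3) (c k)) then m % 3
        else 2 - m % 3 := by
  simp [peanoCell]

theorem peanoCell_succ_of_ne (c : ℕ → ι) (k m : ℕ) {i : ι} (h : i ≠ c k) :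
    peanoCell c (k + 1) m i = peanoCell c k (m / 3) i := by
  simp [peanoCell, h]

theorem sum_peanoCell_succ (c : ℕ → ι) (k m : ℕ) :
    ∑ j, peanoCell c (k + 1) m j + peanoCell c k (m / 3) (c k) =
      ∑ j, peanoCell c k (m / 3) j + peanoCell c (k + 1) m (c k) := by
  rw [peanoCell_succ_self]
  exact sum_update_add _ _ _

/-- Consecutive cells differ in one coordinate only, by a unit step whose sign is given by the
parity of the sum of the other coordinates. -/
theorem exists_step_peanoCell (c : ℕ → ι) (k m : ℕ) :
    ∃ j, (∀ i, i ≠ j → peanoCell c k (m + 1) i = peanoCell c k m i) ∧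
      (Even (∑ l, peanoCell c k m l + peanoCell c k m j) →
        peanoCell c k (m + 1) j = peanoCell c k m j + 1) ∧
      (¬ Even (∑ l, peanoCell c k m l + peanoCell c k m j) →
        peanoCell c k m j = peanoCell c k (m + 1) j + 1) := by
  induction k generalizing m with
  | zero =>
    refine ⟨c 0, fun i hi => by simp [peanoCell, hi], ?_, ?_⟩
    · simp [peanoCell]
    · simp [peanoCell]
  | succ k ih =>
    have hs := sum_peanoCell_succ c k m
    have hv := peanoCell_succ_self c k m
    have hv' := peanoCell_succ_self c k (m + 1)
    by_cases hm : m % 3 = 2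
    · have h1 : (m + 1) / 3 = m / 3 + 1 := by omega
      have h2 : (m + 1) % 3 = 0 := by omega
      obtain ⟨j, hj, hj1, hj2⟩ := ih (m / 3)
      have hS : ∑ l, peanoCell c k (m / 3 + 1) l + peanoCell c k (m / 3) j =
          ∑ l, peanoCell c k (m / 3) l + peanoCell c k (m / 3 + 1) j := by
        rw [← sum_update_add]
        congr 2 with l
        rcases eq_or_ne l j with rfl | hl <;> simp [*]
      rw [h1, h2] at hv'
      rw [hm] at hv
      refine ⟨j, fun i hi => ?_, ?_⟩
      · rcases eq_or_ne i (c k) with rfl | hik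
        · have := hj _ hi
          grind
        · rw [peanoCell_succ_of_ne c k _ hik, peanoCell_succ_of_ne c k _ hik, h1, hj i hi]
      · rcases eq_or_ne j (c k) with rfl | hik
        · grind
        · have e1 := peanoCell_succ_of_ne c k m hik
          have e2 := peanoCell_succ_of_ne c k (m + 1) hik
          rw [h1] at e2
          grind
    · have h1 : (m + 1) / 3 = m / 3 := by omega
      have h2 : (m + 1) % 3 = m % 3 + 1 := by omega
      rw [h1, h2] at hv'
      refine ⟨c k, fun i hi => ?_, ?_⟩
      · rw [peanoCell_succ_of_ne c k _ hi, peanoCell_succ_of_ne c k _ hi, h1]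
      · grind

theorem peanoCell_succ_le (c : ℕ → ι) (k m : ℕ) (i : ι) :
    peanoCell c k (m + 1) i ≤ peanoCell c k m i + 1 ∧
      peanoCell c k m i ≤ peanoCell c k (m + 1) i + 1 := by
  obtain ⟨j, h, h1, h2⟩ := exists_step_peanoCell c k m
  rcases eq_or_ne i j with rfl | hij
  · by_cases he : Even (∑ l, peanoCell c k m l + peanoCell c k m i)
    · have := h1 he; omega
    · have := h2 he; omega
  · have := h i hij; omega

theorem peanoCell_succ_bounds (c : ℕ → ι) (k m : ℕ) (i : ι) :
    3 ^ (if c k = i then 1 else 0) * peanoCell c k (m / 3) i ≤ peanoCell c (k + 1) m i ∧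
      peanoCell c (k + 1) m i + 1 ≤
        3 ^ (if c k = i then 1 else 0) * (peanoCell c k (m / 3) i + 1) := by
  rcases eq_or_ne i (c k) with rfl | hi
  · rw [peanoCell_succ_self, if_pos rfl, pow_one]
    split_ifs <;> omega
  · rw [peanoCell_succ_of_ne c k m hi, if_neg hi.symm]
    omega

theorem peanoCell_lt (c : ℕ → ι) {k m : ℕ} (hm : m < 3 ^ k) (i : ι) :
    peanoCell c k m i < 3 ^ Nat.count (c · = i) k := by
  induction k generalizing m with
  | zero =>
    obtain rfl : m = 0 := by simpa using hm
    simp [peanoCell]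
  | succ k ih =>
    have h := ih (m := m / 3) (by rw [pow_succ] at hm; omega)
    rw [Nat.count_succ, pow_add, mul_comm]
    exact (peanoCell_succ_bounds c k m i).2.trans (Nat.mul_le_mul_left _ h)

theorem peanoCell_injective (c : ℕ → ι) (k : ℕ) : Function.Injective (peanoCell c k) := by
  induction k with
  | zero => exact Pi.single_injective (M := fun _ => ℕ) (c 0)
  | succ k ih =>
    intro m m' h
    have hd : m / 3 = m' / 3 := by
      refine ih (funext fun i => ?_)
      have hi := congrFun h i
      rcases eq_or_ne i (c k) with rfl | hik
      · rw [peanoCell_succ_self, peanoCell_succ_self] at hi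
        split_ifs at hi <;> omega
      · rwa [peanoCell_succ_of_ne c k m hik, peanoCell_succ_of_ne c k m' hik] at hi
    have hr := congrFun h (c k)
    rw [peanoCell_succ_self, peanoCell_succ_self, hd] at hr
    split_ifs at hr <;> omega

theorem exists_peanoCell_eq (c : ℕ → ι) {k : ℕ} {g : ι → ℕ}
    (hg : ∀ i, g i < 3 ^ Nat.count (c · = i) k) : ∃ m < 3 ^ k, peanoCell c k m = g := by
  induction k generalizing g with
  | zero => exact ⟨0, by simp, by ext i; have := hg i; simp_all [peanoCell]⟩
  | succ k ih =>
    obtain ⟨m, hm, he⟩ := ih (g := Function.update g (c k) (g (c k) / 3)) fun i => by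
      have := hg i
      rcases eq_or_ne i (c k) with rfl | hi
      · rw [Nat.count_succ, if_pos rfl, pow_succ] at this
        rw [Function.update_self]
        omega
      · simpa [Nat.count_succ, hi, hi.symm] using this
    set r := if Even (∑ j, peanoCell c k m j + peanoCell c k m (c k)) then g (c k) % 3
      else 2 - g (c k) % 3 with hr
    have hr3 : r < 3 := by rw [hr]; split_ifs <;> omega
    have hd : (3 * m + r) / 3 = m := by omega
    have hmod : (3 * m + r) % 3 = r := by omega
    refine ⟨3 * m + r, by rw [pow_succ]; omega, funext fun i => ?_⟩
    rcases eq_or_ne i (c k) with rfl | hi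
    · have h1 : peanoCell c k m (c k) = g (c k) / 3 := by simp [he]
      rw [peanoCell_succ_self, hd, hmod, hr, h1]
      split_ifs <;> omega
    · rw [peanoCell_succ_of_ne c k _ hi, hd, he, Function.update_of_ne hi]

/-- The coordinatewise lower corner of the `k`-th level cell that the Peano curve visits at
time `t`. -/
noncomputable def peanoApprox (c : ℕ → ι) (k : ℕ) (t : ℝ) (i : ι) : ℝ :=
  peanoCell c k ⌊3 ^ k * t⌋₊ i / 3 ^ Nat.count (c · = i) k

/-- The Peano curve splitting the coordinates in the order `c 0, c 1, …`. -/
noncomputable def peanoCurve (c : ℕ → ι) (t : ℝ) (i : ι) : ℝ :=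
  ⨆ k, peanoApprox c k t i

theorem floor_three_pow_succ_mul_div (k : ℕ) (t : ℝ) :
    ⌊(3 : ℝ) ^ (k + 1) * t⌋₊ / 3 = ⌊(3 : ℝ) ^ k * t⌋₊ := by
  rw [← Nat.floor_div_natCast]
  congr 1
  rw [pow_succ]
  push_cast
  ring

theorem peanoApprox_succ_bounds (c : ℕ → ι) (k : ℕ) (t : ℝ) (i : ι) :
    peanoApprox c k t i ≤ peanoApprox c (k + 1) t i ∧
      peanoApprox c (k + 1) t i + 1 / 3 ^ Nat.count (c · = i) (k + 1) ≤
        peanoApprox c k t i + 1 / 3 ^ Nat.count (c · = i) k := by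
  obtain ⟨h1, h2⟩ := peanoCell_succ_bounds c k ⌊(3 : ℝ) ^ (k + 1) * t⌋₊ i
  rw [floor_three_pow_succ_mul_div] at h1 h2
  have h1' := (Nat.cast_le (α := ℝ)).2 h1
  have h2' := (Nat.cast_le (α := ℝ)).2 h2
  push_cast at h1' h2'
  rw [peanoApprox, peanoApprox, ← add_div, ← add_div, Nat.count_succ,
    pow_add 3 (Nat.count (c · = i) k)]
  constructor
  · rw [div_le_div_iff₀ (by positivity) (by positivity)]
    nlinarith [pow_pos (three_pos (α := ℝ)) (Nat.count (c · = i) k)]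
  · rw [div_le_div_iff₀ (by positivity) (by positivity)]
    nlinarith [pow_pos (three_pos (α := ℝ)) (Nat.count (c · = i) k)]

theorem peanoCurve_mem_Icc (c : ℕ → ι) (k : ℕ) (t : ℝ) (i : ι) :
    peanoCurve c t i ∈ Set.Icc (peanoApprox c k t i)
      (peanoApprox c k t i + 1 / 3 ^ Nat.count (c · = i) k) := by
  have h := Monotone.ciSup_mem_iInter_Icc_of_antitone (f := fun k => peanoApprox c k t i)
    (g := fun k => peanoApprox c k t i + 1 / 3 ^ Nat.count (c · = i) k)
    (monotone_nat_of_le_succ fun k => (peanoApprox_succ_bounds c k t i).1)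
    (antitone_nat_of_succ_le fun k => (peanoApprox_succ_bounds c k t i).2)
    (fun k => le_add_of_nonneg_right (by positivity))
  exact Set.mem_iInter.1 h k

theorem measurable_peanoApprox (c : ℕ → ι) (k : ℕ) : Measurable (peanoApprox c k) := by
  refine measurable_pi_lambda _ fun i => ?_
  have : Measurable fun m : ℕ => (peanoCell c k m i : ℝ) / 3 ^ Nat.count (c · = i) k :=
    measurable_of_countable _
  exact this.comp (Nat.measurable_floor.comp (measurable_const_mul _))

theorem measurable_peanoCurve (c : ℕ → ι) : Measurable (peanoCurve c) :=
  measurable_pi_lambda _ fun i => Measurable.iSup fun k =>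
    (measurable_pi_apply i).comp (measurable_peanoApprox c k)

theorem peanoCell_le (c : ℕ → ι) {k m : ℕ} (hm : m ≤ 3 ^ k) (i : ι) :
    peanoCell c k m i ≤ 3 ^ Nat.count (c · = i) k := by
  rcases hm.lt_or_eq with h | h
  · exact (peanoCell_lt c h i).le
  · obtain ⟨m, rfl⟩ := Nat.exists_eq_add_one_of_ne_zero (h.trans_ne (by positivity))
    have := (peanoCell_succ_le c k m i).1
    have := peanoCell_lt c (show m < 3 ^ k by omega) i
    omega

theorem peanoCurve_mem_unitInterval (c : ℕ → ι) {t : ℝ} (ht : t ≤ 1) (i : ι) :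
    peanoCurve c t i ∈ Set.Icc (0 : ℝ) 1 := by
  refine ⟨le_trans ?_ (peanoCurve_mem_Icc c 0 t i).1, ciSup_le fun k => ?_⟩
  · exact div_nonneg (Nat.cast_nonneg _) (by positivity)
  · rw [peanoApprox, div_le_one (by positivity)]
    have : ⌊(3 : ℝ) ^ k * t⌋₊ ≤ 3 ^ k := by
      refine Nat.floor_le_of_le ?_
      push_cast
      exact mul_le_of_le_one_right (by positivity) ht
    exact_mod_cast peanoCell_le c this i

theorem abs_peanoApprox_sub_le (c : ℕ → ι) (k : ℕ) {s t : ℝ} (hs : 0 ≤ s) (hst : s ≤ t)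
    (h : t - s ≤ 1 / 3 ^ k) (i : ι) :
    |peanoApprox c k s i - peanoApprox c k t i| ≤ 1 / 3 ^ Nat.count (c · = i) k := by
  have h3 : (0 : ℝ) < 3 ^ k := by positivity
  have hlo : ⌊(3 : ℝ) ^ k * s⌋₊ ≤ ⌊(3 : ℝ) ^ k * t⌋₊ := Nat.floor_le_floor (by gcongr)
  have hhi : ⌊(3 : ℝ) ^ k * t⌋₊ ≤ ⌊(3 : ℝ) ^ k * s⌋₊ + 1 := by
    rw [← Nat.floor_add_one (by positivity)]
    refine Nat.floor_le_floor ?_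
    rw [le_div_iff₀ h3] at h
    linarith
  rw [peanoApprox, peanoApprox, ← sub_div, abs_div, abs_of_pos (a := (3 : ℝ) ^ _) (by positivity)]
  gcongr
  obtain he | he : ⌊(3 : ℝ) ^ k * t⌋₊ = ⌊(3 : ℝ) ^ k * s⌋₊ ∨
      ⌊(3 : ℝ) ^ k * t⌋₊ = ⌊(3 : ℝ) ^ k * s⌋₊ + 1 := by omega
  · simp [he]
  · obtain ⟨h1, h2⟩ := peanoCell_succ_le c k ⌊(3 : ℝ) ^ k * s⌋₊ i
    rw [he, abs_le]
    constructor <;> rify at h1 h2 <;> linarith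

theorem abs_peanoCurve_sub_le (c : ℕ → ι) (k : ℕ) {s t : ℝ} (hs : 0 ≤ s) (ht : 0 ≤ t)
    (h : |s - t| ≤ 1 / 3 ^ k) (i : ι) :
    |peanoCurve c s i - peanoCurve c t i| ≤ 2 / 3 ^ Nat.count (c · = i) k := by
  wlog hst : s ≤ t generalizing s t
  · rw [abs_sub_comm]
    exact this ht hs (by rwa [abs_sub_comm]) (le_of_not_ge hst)
  rw [abs_sub_comm, abs_of_nonneg (sub_nonneg.2 hst)] at h
  have h0 := abs_le.1 (abs_peanoApprox_sub_le c k hs hst h i)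
  have h1 := peanoCurve_mem_Icc c k s i
  have h2 := peanoCurve_mem_Icc c k t i
  have h3 : (2 : ℝ) / 3 ^ Nat.count (c · = i) k =
    1 / 3 ^ Nat.count (c · = i) k + 1 / 3 ^ Nat.count (c · = i) k := by ring
  rw [abs_le, h3]
  constructor <;> linarith [h0.1, h0.2, h1.1, h1.2, h2.1, h2.2]

/-- If the splitting order `c` is balanced, the Peano curve is Hölder continuous with exponent
the inverse of the dimension. -/
theorem abs_peanoCurve_sub_le_rpow [Nonempty ι] {c : ℕ → ι}
    (hc : ∀ n i, Nat.count (c · = i) (n * Fintype.card ι) = n) {s t : ℝ}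
    (hs : s ∈ Set.Icc (0 : ℝ) 1) (ht : t ∈ Set.Icc (0 : ℝ) 1) (i : ι) :
    |peanoCurve c s i - peanoCurve c t i| ≤ 6 * |s - t| ^ ((1 : ℝ) / Fintype.card ι) := by
  rcases eq_or_ne s t with rfl | hne
  · simp only [sub_self, abs_zero]
    positivity
  have hd : Fintype.card ι ≠ 0 := Fintype.card_ne_zero
  have hpos : 0 < |s - t| := abs_pos.2 (sub_ne_zero.2 hne)
  have hle : |s - t| ≤ 1 := abs_le.2 ⟨by linarith [hs.1, ht.2], by linarith [hs.2, ht.1]⟩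
  obtain ⟨n, hn1, hn2⟩ := exists_nat_pow_near_of_lt_one hpos hle
    (y := ((1 : ℝ) / 3) ^ Fintype.card ι) (by positivity)
    (pow_lt_one₀ (by norm_num) (by norm_num) hd)
  have hroot : ((1 : ℝ) / 3) ^ (n + 1) ≤ |s - t| ^ ((1 : ℝ) / Fintype.card ι) := by
    rw [← pow_mul, mul_comm, pow_mul] at hn1
    have := Real.rpow_le_rpow (by positivity) hn1.le
      (show 0 ≤ (1 : ℝ) / Fintype.card ι by positivity)
    rwa [one_div (Fintype.card ι : ℝ), Real.pow_rpow_inv_natCast (by positivity) hd,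
      ← one_div (Fintype.card ι : ℝ)] at this
  have h := abs_peanoCurve_sub_le c (n * Fintype.card ι) hs.1 ht.1
    (by rwa [← pow_mul, mul_comm, one_div_pow] at hn2) i
  rw [hc] at h
  refine h.trans ?_
  calc (2 : ℝ) / 3 ^ n = 6 * (1 / 3) ^ (n + 1) := by
        rw [one_div_pow, pow_succ]
        field_simp
        norm_num
    _ ≤ _ := by gcongr

theorem mem_Ico_and_floor_mul_eq_iff {a : ℝ} {m : ℕ} (ha : 0 < a) (hm : (m : ℝ) + 1 ≤ a) (t : ℝ) :
    (⌊a * t⌋₊ = m ∧ t ∈ Set.Ico (0 : ℝ) 1) ↔ t ∈ Set.Ico (m / a) ((m + 1) / a) := by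
  rw [Set.mem_Ico, Set.mem_Ico, div_le_iff₀ ha, lt_div_iff₀ ha, mul_comm t a]
  constructor
  · rintro ⟨h, h0, -⟩
    exact (Nat.floor_eq_iff (by positivity)).1 h
  · rintro ⟨h0, h1⟩
    have h2 : 0 ≤ a * t := (Nat.cast_nonneg _).trans h0
    exact ⟨(Nat.floor_eq_iff h2).2 ⟨h0, h1⟩, nonneg_of_mul_nonneg_right h2 ha,
      by by_contra! h; nlinarith⟩

theorem floor_mul_lt_three_pow (k : ℕ) {t : ℝ} (ht : t ∈ Set.Ico (0 : ℝ) 1) :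
    ⌊(3 : ℝ) ^ k * t⌋₊ < 3 ^ k := by
  rw [Nat.floor_lt (mul_nonneg (by positivity) ht.1)]
  push_cast
  exact mul_lt_of_lt_one_right (by positivity) ht.2

theorem measurable_peanoCell_floor (c : ℕ → ι) (k : ℕ) :
    Measurable fun t : ℝ => peanoCell c k ⌊3 ^ k * t⌋₊ :=
  (measurable_of_countable (peanoCell c k)).comp
    (Nat.measurable_floor.comp (measurable_const_mul _))

theorem measurable_pi_floor_mul {κ : Type*} (a : ℝ) :
    Measurable fun (x : κ → ℝ) i => ⌊a * x i⌋₊ :=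
  measurable_pi_lambda _ fun i =>
    Nat.measurable_floor.comp ((measurable_const_mul _).comp (measurable_pi_apply i))

/-- Both the cells visited at a uniform random time and the cell containing a uniform random point
are uniformly distributed. -/
theorem map_peanoCell_floor {c : ℕ → ι}
    (hc : ∀ n i, Nat.count (c · = i) (n * Fintype.card ι) = n) (n : ℕ) :
    (volume.restrict (Set.Ico (0 : ℝ) 1)).map
        (fun t => peanoCell c (n * Fintype.card ι) ⌊3 ^ (n * Fintype.card ι) * t⌋₊) =
      (volume.restrict (Set.univ.pi fun _ : ι => Set.Ico (0 : ℝ) 1)).map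
        (fun x i => ⌊3 ^ n * x i⌋₊) := by
  set k := n * Fintype.card ι with hk
  have hm1 := measurable_peanoCell_floor c k
  have hm2 := measurable_pi_floor_mul (κ := ι) (3 ^ n)
  refine Measure.ext_of_singleton fun g => ?_
  have hg := measurableSet_singleton g
  rw [Measure.map_apply hm1 hg, Measure.map_apply hm2 hg, Measure.restrict_apply (hm1 hg),
    Measure.restrict_apply (hm2 hg)]
  by_cases hbox : ∀ i, g i < 3 ^ n
  · obtain ⟨m, hm, rfl⟩ := exists_peanoCell_eq c (k := k) (g := g) (by simpa only [hk, hc])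
    have h1 : (fun t : ℝ => peanoCell c k ⌊3 ^ k * t⌋₊) ⁻¹' {peanoCell c k m} ∩ Set.Ico 0 1 =
        Set.Ico (m / 3 ^ k : ℝ) ((m + 1) / 3 ^ k) := by
      ext t
      rw [← mem_Ico_and_floor_mul_eq_iff (by positivity) (by exact_mod_cast hm)]
      simp [(peanoCell_injective c k).eq_iff]
    have h2 : (fun (x : ι → ℝ) i => ⌊3 ^ n * x i⌋₊) ⁻¹' {peanoCell c k m} ∩
          Set.univ.pi (fun _ : ι => Set.Ico (0 : ℝ) 1) =
        Set.univ.pi fun i => Set.Ico (peanoCell c k m i / 3 ^ n : ℝ)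
          ((peanoCell c k m i + 1) / 3 ^ n) := by
      ext x
      simp only [Set.mem_inter_iff, Set.mem_preimage, Set.mem_singleton_iff, funext_iff,
        Set.mem_univ_pi, ← forall_and]
      exact forall_congr' fun i =>
        mem_Ico_and_floor_mul_eq_iff (by positivity) (by exact_mod_cast hbox i) _
    rw [h1, h2, Real.volume_Ico, Real.volume_pi_Ico]
    simp only [← sub_div, add_sub_cancel_left, Finset.prod_const, Finset.card_univ]
    rw [← ENNReal.ofReal_pow (by positivity), one_div_pow, ← pow_mul]
  · refine (measure_mono_null (t := ∅) ?_ measure_empty).trans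
      (measure_mono_null (t := ∅) ?_ measure_empty).symm
    · rintro t ⟨rfl, ht⟩
      refine hbox fun i => ?_
      have := peanoCell_lt c (floor_mul_lt_three_pow k ht) i
      rwa [hk, hc] at this
    · rintro x ⟨rfl, hx⟩
      exact hbox fun i => floor_mul_lt_three_pow n (hx i trivial)

theorem tendsto_peanoApprox {c : ℕ → ι}
    (hc : ∀ n i, Nat.count (c · = i) (n * Fintype.card ι) = n) (t : ℝ) :
    Filter.Tendsto (fun n => peanoApprox c (n * Fintype.card ι) t) Filter.atTop
      (nhds (peanoCurve c t)) := by
  refine tendsto_pi_nhds.2 fun i => ?_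
  have h0 : Filter.Tendsto (fun n : ℕ => peanoCurve c t i - 1 / (3 : ℝ) ^ n) Filter.atTop
      (nhds (peanoCurve c t i - 0)) := by
    refine tendsto_const_nhds.sub ?_
    simp_rw [← one_div_pow]
    exact tendsto_pow_atTop_nhds_zero_of_lt_one (by norm_num) (by norm_num)
  rw [sub_zero] at h0
  refine tendsto_of_tendsto_of_tendsto_of_le_of_le h0 tendsto_const_nhds (fun n => ?_)
    (fun n => (peanoCurve_mem_Icc c _ t i).1)
  have := (peanoCurve_mem_Icc c (n * Fintype.card ι) t i).2
  rw [hc] at this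
  exact sub_le_iff_le_add.2 this

/-- If the splitting order `c` is balanced, the Peano curve is measure preserving. -/
theorem measurePreserving_peanoCurve {c : ℕ → ι}
    (hc : ∀ n i, Nat.count (c · = i) (n * Fintype.card ι) = n) :
    MeasurePreserving (peanoCurve c) (volume.restrict (Set.Icc (0 : ℝ) 1))
      (volume.restrict (Set.Icc (0 : ι → ℝ) 1)) := by
  refine ⟨measurable_peanoCurve c, ?_⟩
  have hI : volume.restrict (Set.Icc (0 : ι → ℝ) 1) =
      volume.restrict (Set.univ.pi fun _ : ι => Set.Ico (0 : ℝ) 1) :=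
    (Measure.restrict_congr_set Measure.univ_pi_Ico_ae_eq_Icc).symm
  rw [hI, Measure.restrict_congr_set Ico_ae_eq_Icc.symm]
  have : IsFiniteMeasure
      (volume.restrict (Set.univ.pi fun _ : ι => Set.Ico (0 : ℝ) 1)) := by
    rw [← hI]
    exact ⟨by simpa using isCompact_Icc.measure_lt_top⟩
  refine ext_of_forall_integral_eq_of_IsFiniteMeasure fun f => ?_
  rw [integral_map (measurable_peanoCurve c).aemeasurable
    f.continuous.aestronglyMeasurable]
  have hf : ∀ x, ‖f x‖ ≤ ‖f‖ := f.norm_coe_le_norm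
  have h1 := tendsto_integral_of_dominated_convergence
    (μ := volume.restrict (Set.Ico (0 : ℝ) 1)) (fun _ => ‖f‖)
    (F := fun n t => f (peanoApprox c (n * Fintype.card ι) t)) (f := fun t => f (peanoCurve c t))
    (fun n => (f.continuous.measurable.comp (measurable_peanoApprox c _)).aestronglyMeasurable)
    (integrable_const _) (fun n => .of_forall fun t => hf _)
    (.of_forall fun t => (f.continuous.tendsto _).comp (tendsto_peanoApprox hc t))
  have h2 := tendsto_integral_of_dominated_convergence
    (μ := volume.restrict (Set.univ.pi fun _ : ι => Set.Ico (0 : ℝ) 1)) (fun _ => ‖f‖)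
    (F := fun n x => f (fun i => (⌊3 ^ n * x i⌋₊ : ℝ) / 3 ^ n)) (f := fun x => f x)
    (fun n => ?_) (integrable_const _) (fun n => .of_forall fun t => hf _) ?_
  · refine tendsto_nhds_unique h1 (h2.congr fun n => ?_)
    have h3 := measurable_of_countable fun g : ι → ℕ => f fun i => (g i : ℝ) / 3 ^ n
    have h4 := congrArg (fun μ => ∫ g, f (fun i => (g i : ℝ) / 3 ^ n) ∂μ)
      (map_peanoCell_floor hc n)
    rw [integral_map (measurable_peanoCell_floor c _).aemeasurable h3.aestronglyMeasurable,
      integral_map (measurable_pi_floor_mul _).aemeasurable h3.aestronglyMeasurable] at h4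
    refine h4.symm.trans (integral_congr_ae (.of_forall fun t => congrArg f (funext fun i => ?_)))
    rw [peanoApprox, hc]
  · have h3 := measurable_of_countable fun g : ι → ℕ => f fun i => (g i : ℝ) / 3 ^ n
    exact (h3.comp (measurable_pi_floor_mul _)).aestronglyMeasurable
  · refine (ae_restrict_iff' (MeasurableSet.univ_pi fun _ => measurableSet_Ico)).2
      (.of_forall fun x hx => (f.continuous.tendsto _).comp (tendsto_pi_nhds.2 fun i => ?_))
    have := (tendsto_nat_floor_mul_div_atTop (hx i trivial).1).comp
      (tendsto_pow_atTop_atTop_of_one_lt (r := (3 : ℝ)) (by norm_num))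
    simpa only [Function.comp_def, mul_comm] using this

end PeanoCell

theorem count_natMod_eq {d : ℕ} (hd : 0 < d) (n : ℕ) (i : Fin d) :
    Nat.count (fun k => (⟨k % d, Nat.mod_lt k hd⟩ : Fin d) = i) (n * d) = n := by
  have h := Nat.count_modEq_card (n * d) hd i
  simpa [Nat.ModEq, Nat.mod_eq_of_lt i.2, hd, Fin.ext_iff] using h

/-- For every `d ≥ 2` there is a measure-preserving Peano curve
`φ : [0,1] → [0,1]^d` that is Hölder(1/d) (w.r.t. the Euclidean norm on `ℝ^d`). -/
theorem exists_measurePreserving_holder_peano_curve (d : ℕ) (hd : 2 ≤ d) :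
    ∃ φ : ℝ → EuclideanSpace ℝ (Fin d),
      MeasurePreserving φ (volume.restrict (Set.Icc (0:ℝ) 1))
        (volume.restrict (unitCube d)) ∧
      Set.MapsTo φ (Set.Icc (0:ℝ) 1) (unitCube d) ∧
      ∃ C : ℝ, ∀ s ∈ Set.Icc (0:ℝ) 1, ∀ t ∈ Set.Icc (0:ℝ) 1,
        dist (φ s) (φ t) ≤ C * |s - t| ^ ((1:ℝ) / d) := by
  have hd0 : 0 < d := by omega
  have : Nonempty (Fin d) := ⟨⟨0, hd0⟩⟩
  let c : ℕ → Fin d := fun k => ⟨k % d, Nat.mod_lt k hd0⟩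
  have hc : ∀ n i, Nat.count (c · = i) (n * Fintype.card (Fin d)) = n := fun n i => by
    rw [Fintype.card_fin]
    exact count_natMod_eq hd0 n i
  have hcube : WithLp.toLp 2 ⁻¹' unitCube d = Set.Icc (0 : Fin d → ℝ) 1 := by
    ext x
    simp [unitCube, Pi.le_def, forall_and]
  refine ⟨fun t => WithLp.toLp 2 (peanoCurve c t), ?_,
    fun t ht i => peanoCurve_mem_unitInterval c ht.2 i, √d * 6, fun s hs t ht => ?_⟩
  · refine MeasurePreserving.comp ?_ (measurePreserving_peanoCurve hc)
    rw [← hcube]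
    exact (PiLp.volume_preserving_toLp (Fin d)).restrict_preimage_emb
      (MeasurableEquiv.toLp 2 (Fin d → ℝ)).measurableEmbedding _
  · have h := fun i => abs_peanoCurve_sub_le_rpow hc hs ht i
    rw [Fintype.card_fin] at h
    rw [EuclideanSpace.dist_eq, mul_assoc]
    set M := 6 * |s - t| ^ ((1 : ℝ) / d) with hM
    have hM0 : 0 ≤ M := by positivity
    rw [← Real.sqrt_sq hM0, ← Real.sqrt_mul (by positivity)]
    refine Real.sqrt_le_sqrt ?_
    calc ∑ i, dist (peanoCurve c s i) (peanoCurve c t i) ^ 2 ≤ ∑ _i : Fin d, M ^ 2 :=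
          Finset.sum_le_sum fun i _ => pow_le_pow_left₀ dist_nonneg (h i) 2
      _ = d * M ^ 2 := by simp
end

section
/- Let (S₁, μ₁) and (S₂, μ₂) be probability spaces, let W be a graphon on S₂, let φ : S₁ → S₂ be measure-preserving, and let W' : S₁ × S₁ → [0,1] be measurable with W'(x,y) = W(φ(x), φ(y)) for μ₁×μ₁-almost every (x,y). Then Ψ_q(W') = Ψ_q(W) for every q > 0. -/
open MeasureTheory
open scoped ENNReal

/-- The smoothness functional
`Ψ_q(W) = ∫∫ (∫ |W(x,z) − W(y,z)| dμ(z))^{−q} dμ(x) dμ(y) ∈ [0,∞]`. -/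
noncomputable def Psi {S : Type*} [MeasurableSpace S] (μ : Measure S) (q : ℝ)
    (W : S → S → ℝ) : ℝ≥0∞ :=
  ∫⁻ x, ∫⁻ y, (∫⁻ z, ENNReal.ofReal |W x z - W y z| ∂μ) ^ (-q) ∂μ ∂μ

/-- The functional `Psi` depends on the kernel only up to almost everywhere equality. -/
theorem Psi_congr_ae {S : Type*} [MeasurableSpace S] {μ : Measure S} [SFinite μ] (q : ℝ)
    {U V : S → S → ℝ} (h : ∀ᵐ p ∂(μ.prod μ), U p.1 p.2 = V p.1 p.2) :
    Psi μ q U = Psi μ q V := by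
  have h' := Measure.ae_ae_of_ae_prod h
  refine lintegral_congr_ae ?_
  filter_upwards [h'] with x hx
  refine lintegral_congr_ae ?_
  filter_upwards [h'] with y hy
  congr 1
  refine lintegral_congr_ae ?_
  filter_upwards [hx, hy] with z hxz hyz
  rw [hxz, hyz]

/-- The functional `Psi` is invariant under pull-back along a measure-preserving map. -/
theorem Psi_comp_measurePreserving {S T : Type*} [MeasurableSpace S] [MeasurableSpace T]
    {μ : Measure S} {ν : Measure T} [SFinite ν] {φ : S → T} (hφ : MeasurePreserving φ μ ν)
    (q : ℝ) {W : T → T → ℝ} (hW : Measurable (Function.uncurry W)) :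
    Psi μ q (fun x y => W (φ x) (φ y)) = Psi ν q W := by
  have hdiff : Measurable fun p : (T × T) × T =>
      ENNReal.ofReal |W p.1.1 p.2 - W p.1.2 p.2| := by
    have h₁ : Measurable fun p : (T × T) × T => W p.1.1 p.2 :=
      hW.comp (measurable_fst.fst.prodMk measurable_snd)
    have h₂ : Measurable fun p : (T × T) × T => W p.1.2 p.2 :=
      hW.comp (measurable_fst.snd.prodMk measurable_snd)
    exact (h₁.sub h₂).abs.ennreal_ofReal
  have hpow : Measurable fun p : T × T =>
      (∫⁻ z, ENNReal.ofReal |W p.1 z - W p.2 z| ∂ν) ^ (-q) :=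
    hdiff.lintegral_prod_right'.pow_const (-q)
  unfold Psi
  rw [← hφ.lintegral_comp hpow.lintegral_prod_right']
  refine lintegral_congr fun x => ?_
  refine Eq.trans ?_ (hφ.lintegral_comp (hpow.comp (measurable_prodMk_left (x := φ x))))
  refine lintegral_congr fun y => ?_
  exact congrArg (· ^ (-q)) 
    (hφ.lintegral_comp (hdiff.comp (measurable_prodMk_left (x := (φ x, φ y)))))

/-- If `W'` is a.e. equal to the pull-back of a graphon `W` along a
measure-preserving map `φ`, then `Ψ_q(W') = Ψ_q(W)` for every `q > 0`. -/
theorem Psi_pullback {S₁ S₂ : Type*} [MeasurableSpace S₁] [MeasurableSpace S₂]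
    (μ₁ : Measure S₁) (μ₂ : Measure S₂)
    [IsProbabilityMeasure μ₁] [IsProbabilityMeasure μ₂]
    (W : S₂ → S₂ → ℝ)
    (hWmeas : Measurable (Function.uncurry W))
    (hWsymm : ∀ x y, W x y = W y x)
    (hW01 : ∀ x y, W x y ∈ Set.Icc (0:ℝ) 1)
    (φ : S₁ → S₂) (hφ : MeasurePreserving φ μ₁ μ₂)
    (W' : S₁ → S₁ → ℝ)
    (hW'meas : Measurable (Function.uncurry W'))
    (hW'ae : ∀ᵐ p ∂(μ₁.prod μ₁), W' p.1 p.2 = W (φ p.1) (φ p.2))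
    (q : ℝ) (hq : 0 < q) :
    Psi μ₁ q W' = Psi μ₂ q W := by
  exact (Psi_congr_ae (V := fun x y => W (φ x) (φ y)) q hW'ae).trans
    (Psi_comp_measurePreserving hφ q hWmeas)
end

section
/- Let d ≥ 1, let a > 0, and define W(x,y) := a (x·y) for x, y ∈ [0,1]^d, where x·y is the Euclidean scalar product. Then Ψ_q(W) < ∞ for every q with 0 < q < d. -/
open MeasureTheory
open scoped ENNReal

/-- The reflection `z ↦ 1 - z` in the `i`-th coordinate preserves Lebesgue measure. -/
theorem measurePreserving_update_one_sub {ι : Type*} [Fintype ι] [DecidableEq ι] (i : ι) :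
    MeasurePreserving (fun z : ι → ℝ => Function.update z i (1 - z i)) := by
  have h := volume_preserving_pi (ι := ι) (α' := fun _ => ℝ) (β' := fun _ => ℝ)
    (f := fun j => if j = i then fun t : ℝ => 1 - t else id) (fun j => by
      by_cases hj : j = i
      · simpa [hj] using volume.measurePreserving_sub_left (1 : ℝ)
      · simpa [hj] using MeasurePreserving.id (volume : Measure ℝ))
  convert h using 1
  ext z j
  by_cases hj : j = i
  · subst hj; simp
  · simp [hj]

theorem ofReal_norm_div_le_lintegral_abs_sum {ι : Type*} [Fintype ι] (w : ι → ℝ) :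
    ENNReal.ofReal (‖w‖ / 16) ≤
      ∫⁻ z in Set.Icc (0 : ι → ℝ) 1, ENNReal.ofReal |∑ j, w j * z j| := by
  classical
  cases isEmpty_or_nonempty ι
  · simp [Subsingleton.elim w 0]
  obtain ⟨i, hmax⟩ := Finite.exists_max fun j => ‖w j‖
  have hi : ‖w i‖ = ‖w‖ :=
    le_antisymm (norm_le_pi_norm w i) ((pi_norm_le_iff_of_nonneg (norm_nonneg _)).2 hmax)
  set F : (ι → ℝ) → ℝ≥0∞ := fun z => ENNReal.ofReal |∑ j, w j * z j| with hF
  set σ : (ι → ℝ) → (ι → ℝ) := fun z => Function.update z i (1 - z i) with hσ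
  have hFm : Measurable F := by fun_prop
  have hpre : σ ⁻¹' Set.Icc 0 1 = Set.Icc 0 1 := by
    ext z
    simp only [Set.mem_preimage, Set.mem_Icc, Pi.le_def, hσ, ← forall_and]
    refine forall_congr' fun j => ?_
    by_cases hj : j = i
    · subst hj
      simp only [Function.update_self, Pi.zero_apply, Pi.one_apply]
      constructor <;> rintro ⟨h₁, h₂⟩ <;> constructor <;> linarith
    · simp [hj]
  have hrefl : ∫⁻ z in Set.Icc 0 1, F (σ z) = ∫⁻ z in Set.Icc 0 1, F z := by
    conv_lhs => rw [← hpre]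
    exact (measurePreserving_update_one_sub i).setLIntegral_comp_preimage measurableSet_Icc hFm
  have hsum : ∀ z, ENNReal.ofReal (|w i| * |2 * z i - 1|) ≤ F z + F (σ z) := by
    intro z
    rw [hF, ← ENNReal.ofReal_add (abs_nonneg _) (abs_nonneg _), ← abs_mul]
    refine ENNReal.ofReal_le_ofReal ?_
    have : w i * (2 * z i - 1) = ∑ j, w j * z j - ∑ j, w j * σ z j := by
      rw [← Finset.sum_sub_distrib, Finset.sum_eq_single i]
      · simp only [hσ, Function.update_self]; ring
      · intro j _ hj; simp [hσ, hj]
      · simp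
    rw [this]
    exact abs_sub _ _
  set b : ι → ℝ := Function.update 1 i (1 / 4) with hb
  have hb1 : b ≤ 1 := by
    rw [hb, update_le_iff]
    exact ⟨by norm_num, fun _ _ => le_rfl⟩
  have hvol : volume (Set.Icc 0 b) = ENNReal.ofReal (1 / 4) := by
    rw [Real.volume_Icc_pi, Finset.prod_eq_single i]
    · simp [hb]
    · intro j _ hj; simp [hb, hj]
    · simp
  have hlow : ENNReal.ofReal (‖w‖ / 8) ≤
      ∫⁻ z in Set.Icc (0 : ι → ℝ) 1, ENNReal.ofReal (|w i| * |2 * z i - 1|) := by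
    calc ENNReal.ofReal (‖w‖ / 8)
        = ∫⁻ _ in Set.Icc 0 b, ENNReal.ofReal (‖w‖ / 2) := by
          rw [setLIntegral_const, hvol, ← ENNReal.ofReal_mul (by positivity)]
          congr 1; ring
      _ ≤ ∫⁻ z in Set.Icc 0 b, ENNReal.ofReal (|w i| * |2 * z i - 1|) := by
          refine setLIntegral_mono' measurableSet_Icc fun z hz => ENNReal.ofReal_le_ofReal ?_
          have h := hz.2 i
          simp only [hb, Function.update_self] at h
          rw [← Real.norm_eq_abs (w i), hi, div_eq_mul_one_div]
          gcongr
          rw [le_abs]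
          right; linarith
      _ ≤ _ := lintegral_mono_set (Set.Icc_subset_Icc le_rfl hb1)
  have htwo : ENNReal.ofReal (‖w‖ / 8) ≤ 2 * ∫⁻ z in Set.Icc 0 1, F z := by
    calc _ ≤ _ := hlow
      _ ≤ ∫⁻ z in Set.Icc 0 1, (F z + F (σ z)) := lintegral_mono fun z => hsum z
      _ = _ := by rw [lintegral_add_left hFm, hrefl, two_mul]
  have h16 : ENNReal.ofReal (‖w‖ / 8) = 2 * ENNReal.ofReal (‖w‖ / 16) := by
    rw [← ENNReal.ofReal_ofNat 2, ← ENNReal.ofReal_mul (by norm_num)]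
    congr 1; ring
  rw [h16] at htwo
  exact (ENNReal.mul_le_mul_iff_right (by norm_num) (by norm_num)).1 htwo

/-- Negative powers of the norm of order less than the dimension have finite integral over the
closed unit ball. -/
theorem lintegral_closedBall_ofReal_mul_norm_rpow_neg_lt_top {E : Type*} [NormedAddCommGroup E]
    [NormedSpace ℝ E] [FiniteDimensional ℝ E] [MeasurableSpace E] [BorelSpace E]
    (μ : Measure E) [μ.IsAddHaarMeasure] (hdim : 1 ≤ Module.finrank ℝ E) {c q : ℝ} (hc : 0 < c)
    (hq : q < Module.finrank ℝ E) :
    ∫⁻ u in Metric.closedBall (0 : E) 1, ENNReal.ofReal (c * ‖u‖) ^ (-q) ∂μ < ∞ := by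
  have : Nontrivial E := Module.nontrivial_of_finrank_pos (R := ℝ) hdim
  have hint : IntegrableOn (fun u : E => (c * ‖u‖) ^ (-q)) (Metric.closedBall 0 1) μ := by
    refine (locallyIntegrable_of_norm_le_rpow (C := c ^ (-q)) hdim hq ?_ ?_).integrableOn_isCompact
      (isCompact_closedBall 0 1)
    · refine .of_forall fun u => ?_
      rw [Real.norm_of_nonneg (by positivity), Real.mul_rpow hc.le (norm_nonneg u)]
    · exact Measurable.aestronglyMeasurable (by fun_prop)
  refine lt_of_le_of_lt (lintegral_mono_ae ?_) hint.lintegral_lt_top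
  filter_upwards [ae_restrict_of_ae (μ.ae_ne 0)] with u hu
  rw [ENNReal.ofReal_rpow_of_pos (by positivity)]

theorem lintegral_Icc_sub_le {ι : Type*} [Fintype ι] (f : (ι → ℝ) → ℝ≥0∞) {x : ι → ℝ}
    (hx : x ∈ Set.Icc (0 : ι → ℝ) 1) :
    ∫⁻ y in Set.Icc (0 : ι → ℝ) 1, f (x - y) ≤
      ∫⁻ u in Metric.closedBall (0 : ι → ℝ) 1, f u := by
  rw [← lintegral_indicator measurableSet_Icc,
    ← lintegral_indicator Metric.isClosed_closedBall.measurableSet,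
    ← lintegral_sub_left_eq_self ((Metric.closedBall 0 1).indicator f) x]
  refine lintegral_mono fun y => Set.indicator_apply_le' (fun hy => ?_) fun _ => zero_le
  rw [Set.indicator_of_mem]
  rw [mem_closedBall_zero_iff, pi_norm_le_iff_of_nonneg zero_le_one]
  intro i
  have := hx.1 i; have := hx.2 i; have := hy.1 i; have := hy.2 i
  simp only [Pi.zero_apply, Pi.one_apply] at *
  rw [Pi.sub_apply, Real.norm_eq_abs, abs_le]
  constructor <;> linarith

theorem volume_restrict_unitCube (d : ℕ) :
    (volume.restrict (unitCube d)) =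
      (volume.restrict (Set.Icc (0 : Fin d → ℝ) 1)).map (MeasurableEquiv.toLp 2 (Fin d → ℝ)) := by
  rw [← (PiLp.volume_preserving_toLp (Fin d)).map_eq]
  change Measure.restrict (Measure.map (MeasurableEquiv.toLp 2 (Fin d → ℝ)) volume) _ = _
  rw [MeasurableEquiv.restrict_map]
  congr 2
  ext z
  simp [unitCube, Pi.le_def, forall_and]

/-- **Lemma 3.** For the dot product graphon `W(x,y) = a (x·y)` on `[0,1]^d`,
`Ψ_q(W) < ∞` for every `0 < q < d`. -/
theorem Psi_dotProduct_lt_top (d : ℕ) (hd : 1 ≤ d) (a : ℝ) (ha : 0 < a)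
    (q : ℝ) (hq0 : 0 < q) (hqd : q < d) :
    Psi (volume.restrict (unitCube d)) q
      (fun x y : EuclideanSpace ℝ (Fin d) => a * ∑ i, x i * y i) < ∞ := by
  simp only [Psi, volume_restrict_unitCube, lintegral_map_equiv, MeasurableEquiv.toLp_apply]
  have hlow (x y : Fin d → ℝ) : ENNReal.ofReal (a / 16 * ‖x - y‖) ≤
      ∫⁻ z in Set.Icc (0 : Fin d → ℝ) 1,
        ENNReal.ofReal |a * ∑ i, x i * z i - a * ∑ i, y i * z i| := by
    have h (z : Fin d → ℝ) : ENNReal.ofReal |a * ∑ i, x i * z i - a * ∑ i, y i * z i| =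
        ENNReal.ofReal a * ENNReal.ofReal |∑ i, (x - y) i * z i| := by
      rw [← ENNReal.ofReal_mul ha.le, ← mul_sub, abs_mul, abs_of_pos ha,
        ← Finset.sum_sub_distrib]
      simp only [Pi.sub_apply, sub_mul]
    simp only [h]
    rw [lintegral_const_mul _ (by fun_prop), div_mul_eq_mul_div, mul_div_assoc,
      ENNReal.ofReal_mul ha.le]
    gcongr
    exact ofReal_norm_div_le_lintegral_abs_sum _
  have hK := lintegral_closedBall_ofReal_mul_norm_rpow_neg_lt_top
    (volume : Measure (Fin d → ℝ)) (by simpa using hd) (div_pos ha (by norm_num : (0 : ℝ) < 16))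
    (by simpa using hqd)
  refine lt_of_le_of_lt (setLIntegral_mono' measurableSet_Icc fun x hx =>
    (lintegral_mono fun y => by
      rw [ENNReal.rpow_neg, ENNReal.rpow_neg]
      exact ENNReal.inv_le_inv.2 (ENNReal.rpow_le_rpow (hlow x y) hq0.le)).trans
      (lintegral_Icc_sub_le (fun u => ENNReal.ofReal (a / 16 * ‖u‖) ^ (-q)) hx)) ?_
  rw [setLIntegral_const]
  exact ENNReal.mul_lt_top hK isCompact_Icc.measure_lt_top
end

section
/- Let d ≥ 2 and let W(x,y) := (x·y)/d for x, y ∈ [0,1]^d, where x·y is the Euclidean scalar product. Then for every γ > 1/d, W is not equivalent to any graphon W' on [0,1] that is Hölder(γ); that is, there do not exist a Hölder(γ) graphon W' on [0,1], a graphon U on a probability space (S, μ), and measure-preserving maps φ₁ : [0,1]^d → S and φ₂ : [0,1] → S such that W(x,y) = U(φ₁(x), φ₁(y)) a.e. on [0,1]^{2d} and W'(x,y) = U(φ₂(x), φ₂(y)) a.e. on [0,1]². -/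
open MeasureTheory
open scoped ENNReal

/-- Two graphons (given with their underlying probability measures) are equivalent if both
are a.e. equal to pull-backs of a common graphon `U` on some probability space `(S, μ)`. -/
def GraphonEquiv {S₁ S₂ : Type} [MeasurableSpace S₁] [MeasurableSpace S₂]
    (μ₁ : Measure S₁) (μ₂ : Measure S₂) (W₁ : S₁ → S₁ → ℝ) (W₂ : S₂ → S₂ → ℝ) : Prop :=
  ∃ (S : Type) (mS : MeasurableSpace S),
    letI := mS
    ∃ (μ : Measure S) (U : S → S → ℝ) (φ₁ : S₁ → S) (φ₂ : S₂ → S),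
      IsProbabilityMeasure μ ∧
      Measurable (Function.uncurry U) ∧
      (∀ x y, U x y = U y x) ∧
      (∀ x y, U x y ∈ Set.Icc (0:ℝ) 1) ∧
      MeasurePreserving φ₁ μ₁ μ ∧
      MeasurePreserving φ₂ μ₂ μ ∧
      (∀ᵐ p ∂(μ₁.prod μ₁), W₁ p.1 p.2 = U (φ₁ p.1) (φ₁ p.2)) ∧
      (∀ᵐ p ∂(μ₂.prod μ₂), W₂ p.1 p.2 = U (φ₂ p.1) (φ₂ p.2))

/-- If `U` pulls back along `φ` to a graphon on `[0,1]` whose rows oscillate by at most `ε` over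
distance `1 / n`, then almost every row of `U` is within `ε` of one of `n + 1` fixed rows. -/
lemma exists_rows_ae_close {S : Type*} [MeasurableSpace S] {μ : Measure S} [SFinite μ]
    {U : S → S → ℝ} (hU : Measurable (Function.uncurry U)) {φ : ℝ → S}
    (hφ : MeasurePreserving φ (volume.restrict (Set.Icc (0 : ℝ) 1)) μ) {W : ℝ → ℝ → ℝ}
    (hWU : ∀ᵐ p ∂((volume.restrict (Set.Icc (0 : ℝ) 1)).prod (volume.restrict (Set.Icc (0 : ℝ) 1))),
      W p.1 p.2 = U (φ p.1) (φ p.2))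
    {n : ℕ} (hn : 0 < n) {ε : ℝ}
    (hW : ∀ x ∈ Set.Icc (0 : ℝ) 1, ∀ x' ∈ Set.Icc (0 : ℝ) 1, ∀ y ∈ Set.Icc (0 : ℝ) 1,
      |x - x'| ≤ 1 / n → |W x y - W x' y| ≤ ε) :
    ∃ s : Fin (n + 1) → S, ∀ᵐ x ∂μ, ∃ k, ∀ᵐ z ∂μ, |U x z - U (s k) z| ≤ ε := by
  classical
  let G : Set ℝ := {t | t ∈ Set.Icc (0 : ℝ) 1 ∧
    ∀ᵐ z ∂(volume.restrict (Set.Icc (0 : ℝ) 1)), W t z = U (φ t) (φ z)}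
  have hG : ∀ᵐ t ∂(volume.restrict (Set.Icc (0 : ℝ) 1)), t ∈ G := by
    filter_upwards [ae_restrict_mem measurableSet_Icc, Measure.ae_ae_of_ae_prod hWU] with t h1 h2
    exact ⟨h1, h2⟩
  let rep : Fin (n + 1) → ℝ := fun k ↦
    if h : ∃ t ∈ G, ⌊t * n⌋₊ = k then h.choose else 0
  have hmeas : ∀ s : S, MeasurableSet {x | ∀ᵐ z ∂μ, |U x z - U s z| ≤ ε} := by
    intro s
    have hset : MeasurableSet {p : S × S | ¬ |U p.1 p.2 - U s p.2| ≤ ε} := by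
      have h1 : Measurable fun p : S × S ↦ U p.1 p.2 := hU
      have h2 : Measurable fun p : S × S ↦ U s p.2 :=
        hU.comp (measurable_const.prodMk measurable_snd)
      exact (measurableSet_le (continuous_abs.measurable.comp (h1.sub h2)) measurable_const).compl
    exact measurable_measure_prodMk_left hset (measurableSet_singleton 0)
  have hmeas2 : ∀ x s : S, MeasurableSet {z | |U x z - U s z| ≤ ε} := by
    intro x s
    have h1 (x : S) : Measurable fun z : S ↦ U x z := hU.comp measurable_prodMk_left
    exact measurableSet_le (continuous_abs.measurable.comp ((h1 x).sub (h1 s))) measurable_const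
  refine ⟨fun k ↦ φ (rep k), ?_⟩
  rw [← hφ.map_eq, ae_map_iff hφ.aemeasurable]
  · filter_upwards [hG] with t ht
    have hn' : (0 : ℝ) < n := by exact_mod_cast hn
    have hfl : ⌊t * n⌋₊ < n + 1 := by
      refine Nat.lt_succ_iff.2 (Nat.floor_le_of_le ?_)
      nlinarith [ht.1.2]
    have hex : ∃ u ∈ G, ⌊u * n⌋₊ = (⟨⌊t * n⌋₊, hfl⟩ : Fin (n + 1)) := ⟨t, ht, rfl⟩
    refine ⟨⟨⌊t * n⌋₊, hfl⟩, ?_⟩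
    have hrep : rep ⟨⌊t * n⌋₊, hfl⟩ = hex.choose := dif_pos hex
    rw [hrep]
    obtain ⟨hu, hfu⟩ := hex.choose_spec
    set u := hex.choose
    have hdist : |t - u| ≤ 1 / n := by
      have h1 := Nat.floor_le (mul_nonneg ht.1.1 hn'.le)
      have h2 := Nat.lt_floor_add_one (t * n)
      have h3 := Nat.floor_le (mul_nonneg hu.1.1 hn'.le)
      have h4 := Nat.lt_floor_add_one (u * n)
      simp only at hfu
      rw [hfu] at h3 h4
      rw [le_div_iff₀ hn', ← abs_of_pos hn', ← abs_mul, abs_le]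
      constructor <;> nlinarith
    rw [ae_map_iff hφ.aemeasurable (hmeas2 _ _)]
    filter_upwards [ht.2, hu.2, ae_restrict_mem measurableSet_Icc] with z h1 h2 h3
    rw [← h1, ← h2]
    exact hW t ht.1 u hu.1 z h3 hdist
  · rw [hφ.map_eq, Set.ofPred_exists]
    exact MeasurableSet.iUnion fun k ↦ hmeas _

/-- A linear functional that is a.e. bounded on the unit cube has bounded coefficients. -/
lemma abs_coeff_le_of_ae_cube {ι : Type*} [Fintype ι] {a : ι → ℝ} {c : ℝ}
    (h : ∀ᵐ z ∂(volume.restrict (Set.Icc (0 : ι → ℝ) 1)), |∑ i, a i * z i| ≤ c) (i : ι) :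
    |a i| ≤ c := by
  classical
  have hcl : Set.Icc (0 : ι → ℝ) 1 ⊆ closure (interior (Set.Icc (0 : ι → ℝ) 1)) := by
    rw [← Set.pi_univ_Icc, interior_pi_set Set.finite_univ, closure_pi_set]
    refine Set.pi_mono fun j _ ↦ ?_
    simp
  have heq : Set.EqOn (fun z : ι → ℝ ↦ max |∑ i, a i * z i| c) (fun _ ↦ c)
      (Set.Icc (0 : ι → ℝ) 1) := by
    refine Measure.eqOn_of_ae_eq (μ := volume) ?_ ?_ ?_ hcl
    · filter_upwards [h] with z hz using max_eq_right hz
    · exact Continuous.continuousOn (by fun_prop)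
    · exact continuousOn_const
  have hi := heq (x := Pi.single i 1) ⟨Pi.single_nonneg.2 zero_le_one, fun j ↦ by
    by_cases hj : j = i
    · subst hj; simp
    · simp [hj]⟩
  simpa [Pi.single_apply] using hi

/-- If almost every row of `U` is within `ε` of one of `m` fixed rows, and `U` pulls back to the
normalised dot product on the unit cube, then `m` boxes of side `2 * d * ε` have volume at least
`1`. -/
lemma one_le_card_mul_of_rows_ae_close {S : Type*} [MeasurableSpace S] {μ : Measure S}
    {U : S → S → ℝ} {d : ℕ} (hd : 0 < d) {φ : (Fin d → ℝ) → S}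
    (hφ : MeasurePreserving φ (volume.restrict (Set.Icc (0 : Fin d → ℝ) 1)) μ)
    (hWU : ∀ᵐ p ∂((volume.restrict (Set.Icc (0 : Fin d → ℝ) 1)).prod
        (volume.restrict (Set.Icc (0 : Fin d → ℝ) 1))),
      (∑ i, p.1 i * p.2 i) / d = U (φ p.1) (φ p.2))
    {m : ℕ} {ε : ℝ} (hε : 0 ≤ ε) {s : Fin m → S}
    (hs : ∀ᵐ x ∂μ, ∃ k, ∀ᵐ z ∂μ, |U x z - U (s k) z| ≤ ε) :
    1 ≤ m * (2 * d * ε) ^ d := by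
  have hd' : (0 : ℝ) < d := by exact_mod_cast hd
  let ν : Measure (Fin d → ℝ) := volume.restrict (Set.Icc 0 1)
  let B : Fin m → Set (Fin d → ℝ) := fun k ↦ {x | (∀ᵐ z ∂ν, (∑ i, x i * z i) / d = U (φ x) (φ z)) ∧
    ∀ᵐ z ∂μ, |U (φ x) z - U (s k) z| ≤ ε}
  have hcover : ∀ᵐ x ∂ν, x ∈ ⋃ k, B k := by
    filter_upwards [hφ.quasiMeasurePreserving.ae hs, Measure.ae_ae_of_ae_prod hWU]
      with x ⟨k, hk⟩ h2
    exact Set.mem_iUnion.2 ⟨k, h2, hk⟩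
  have hdiam : ∀ k, ν (B k) ≤ ENNReal.ofReal ((2 * d * ε) ^ d) := by
    intro k
    refine (Measure.restrict_apply_le _ _).trans ((Real.volume_pi_le_diam_pow _).trans ?_)
    rw [Fintype.card_fin, ENNReal.ofReal_pow (by positivity)]
    gcongr
    refine Metric.ediam_le fun x hx y hy ↦ ?_
    rw [edist_dist]
    refine ENNReal.ofReal_le_ofReal ((dist_pi_le_iff (by positivity)).2 fun i ↦ ?_)
    rw [Real.dist_eq]
    refine abs_coeff_le_of_ae_cube (a := fun i ↦ x i - y i) ?_ i
    filter_upwards [hx.1, hy.1, hφ.quasiMeasurePreserving.ae hx.2,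
      hφ.quasiMeasurePreserving.ae hy.2] with z h1 h2 h3 h4
    rw [← h1] at h3
    rw [← h2] at h4
    have hsum : ∑ i, (x i - y i) * z i = d * ((∑ i, x i * z i) / d - (∑ i, y i * z i) / d) := by
      simp only [sub_mul, Finset.sum_sub_distrib]
      field_simp
    rw [hsum, abs_mul, abs_of_pos hd']
    have := abs_sub_le ((∑ i, x i * z i) / d) (U (s k) (φ z)) ((∑ i, y i * z i) / d)
    rw [abs_sub_comm (U (s k) (φ z))] at this
    nlinarith
  have h1 : (1 : ℝ≥0∞) ≤ ENNReal.ofReal (m * (2 * d * ε) ^ d) := calc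
    (1 : ℝ≥0∞) = ν Set.univ := by simp [ν, Real.volume_Icc_pi]
    _ = ν (⋃ k, B k) := (measure_congr (Filter.eventuallyEq_univ.2 hcover)).symm
    _ ≤ ∑ k, ν (B k) := measure_iUnion_fintype_le _ _
    _ ≤ ∑ _k : Fin m, ENNReal.ofReal ((2 * d * ε) ^ d) := Finset.sum_le_sum fun k _ ↦ hdiam k
    _ = ENNReal.ofReal (m * (2 * d * ε) ^ d) := by
      rw [ENNReal.ofReal_mul (by positivity)]
      simp
  exact ENNReal.one_le_ofReal.1 h1

open Filter Topology in
lemma tendsto_succ_mul_rpow_neg_pow {d : ℕ} {γ : ℝ} (h : 1 < γ * d) (K : ℝ) :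
    Tendsto (fun n : ℕ ↦ ((n + 1 : ℕ) : ℝ) * (K * (1 / (n : ℝ)) ^ γ) ^ d) atTop (𝓝 0) := by
  have h1 : Tendsto (fun n : ℕ ↦ K ^ d * ((n : ℝ) ^ (-(γ * d - 1)) + (n : ℝ) ^ (-(γ * d))))
      atTop (𝓝 (K ^ d * (0 + 0))) :=
    (((tendsto_rpow_neg_atTop (by linarith)).comp tendsto_natCast_atTop_atTop).add
      ((tendsto_rpow_neg_atTop (by linarith)).comp tendsto_natCast_atTop_atTop)).const_mul _
  rw [add_zero, mul_zero] at h1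
  refine h1.congr' ?_
  filter_upwards [eventually_gt_atTop 0] with n hn
  have hn' : (0 : ℝ) < n := by exact_mod_cast hn
  rw [mul_pow, one_div, Real.inv_rpow hn'.le, ← Real.rpow_neg hn'.le, ← Real.rpow_mul_natCast hn'.le,
    show -(γ * d - 1) = -γ * d + 1 by ring, Real.rpow_add_one hn'.ne', neg_mul]
  push_cast
  ring

/-- **Example 1.** The dot product graphon `W(x,y) = (x·y)/d` on `[0,1]^d`
(`d ≥ 2`) is not equivalent to any Hölder(γ) graphon on `[0,1]` when `γ > 1/d`. -/
theorem dotProduct_graphon_not_equivalent_holder (d : ℕ) (hd : 2 ≤ d)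
    (γ : ℝ) (hγ : 1 / d < γ) (hγ1 : γ ≤ 1) :
    ¬ ∃ W' : ℝ → ℝ → ℝ,
        Measurable (Function.uncurry W') ∧
        (∀ x ∈ Set.Icc (0:ℝ) 1, ∀ y ∈ Set.Icc (0:ℝ) 1, W' x y = W' y x) ∧
        (∀ x ∈ Set.Icc (0:ℝ) 1, ∀ y ∈ Set.Icc (0:ℝ) 1, W' x y ∈ Set.Icc (0:ℝ) 1) ∧
        (∃ C : ℝ, ∀ x ∈ Set.Icc (0:ℝ) 1, ∀ y ∈ Set.Icc (0:ℝ) 1,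
          ∀ x' ∈ Set.Icc (0:ℝ) 1, ∀ y' ∈ Set.Icc (0:ℝ) 1,
          |W' x y - W' x' y'| ≤ C * Real.sqrt ((x - x') ^ 2 + (y - y') ^ 2) ^ γ) ∧
        GraphonEquiv (volume.restrict (unitCube d)) (volume.restrict (Set.Icc (0:ℝ) 1))
          (fun x y : EuclideanSpace ℝ (Fin d) => (∑ i, x i * y i) / d) W' := by
  rintro ⟨W', -, -, -, ⟨C, hC⟩, S, mS, μ, U, φ₁, φ₂, hμ, hU, -, -, hφ₁, hφ₂, hW, hW'⟩
  have hd0 : (0 : ℝ) < d := by exact_mod_cast (by omega : 0 < d)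
  have hγ0 : 0 < γ := lt_trans (by positivity) hγ
  have hγd : 1 < γ * d := (div_lt_iff₀ hd0).1 hγ
  have he : MeasurePreserving (WithLp.toLp 2 : (Fin d → ℝ) → EuclideanSpace ℝ (Fin d))
      (volume.restrict (Set.Icc 0 1)) (volume.restrict (unitCube d)) := by
    have hpre : Set.Icc (0 : Fin d → ℝ) 1 =
        (WithLp.toLp 2 : (Fin d → ℝ) → EuclideanSpace ℝ (Fin d)) ⁻¹' unitCube d := by
      ext x
      simp [unitCube, Pi.le_def, forall_and]
    rw [hpre]
    refine (PiLp.volume_preserving_toLp (Fin d)).restrict_preimage ?_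
    simp only [unitCube, Set.ofPred_forall]
    exact MeasurableSet.iInter fun i ↦ measurableSet_Icc.preimage (by fun_prop)
  have hbound : ∀ n : ℕ, 0 < n →
      1 ≤ ((n + 1 : ℕ) : ℝ) * ((2 * d * |C|) * (1 / (n : ℝ)) ^ γ) ^ d := by
    intro n hn
    obtain ⟨s, hs⟩ := exists_rows_ae_close (ε := |C| * (1 / (n : ℝ)) ^ γ) hU hφ₂ hW' hn (by
      intro x hx x' hx' y hy hxx
      refine (hC x hx y hy x' hx' y hy).trans ?_
      rw [sub_self, zero_pow two_ne_zero, add_zero, Real.sqrt_sq_eq_abs]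
      gcongr
      exact le_abs_self C)
    have := one_le_card_mul_of_rows_ae_close (by omega) (hφ₁.comp he)
      ((he.prod he).quasiMeasurePreserving.ae hW) (by positivity) hs
    rwa [← mul_assoc] at this
  obtain ⟨n, hlt, hn⟩ := (((tendsto_succ_mul_rpow_neg_pow hγd (2 * d * |C|)).eventually
    (gt_mem_nhds one_pos)).and (Filter.eventually_gt_atTop 0)).exists
  exact absurd (hbound n hn) hlt.not_ge
end
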